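/- arXiv:1305.6002 — 7 statements merged into one kernel-verified Lean document; each statement's English description precedes it below -/
import Mathlib

section
/- (Sufficiency form of Theorem 1.) Let x* be admissible and a* ∈ ℝ. Assume: (i) for each t ∈ [t0, tf] the map (x, v) ↦ g(x, v, a*, t) is convex on ℝ × ℝ; (ii) x* satisfies the Euler–Lagrange equation at a*: the function t ↦ (∂g/∂v)(x*(t), x*'(t), a*, t) is differentiable on [t0, tf] with derivative (∂g/∂x)(x*(t), x*'(t), a*, t); (iii) for each t ∈ [t0, tf] the map a ↦ g(x*(t), x*'(t), a, t) is concave on ℝ; (iv) ∫_{t0}^{tf} (∂g/∂a)(x*(t), x*'(t), a*, t) dt = 0. Then (x*, a*) is a min-max solution of J, i.e. J(x*, a) ≤ J(x*, a*) ≤ J(x, a*) for every a ∈ ℝ and every admissible x. -/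
theorem aux_grad (f : ℝ → ℝ) (f' : ℝ) (hf : ConvexOn ℝ Set.univ f) (h : HasDerivAt f f' 0) :
    f 0 + f' ≤ f 1 := by
  have := hf.le_slope_of_hasDerivAt (Set.mem_univ 0) (Set.mem_univ 1) one_pos h
  simp [slope_def_field] at this
  linarith

theorem aux_dir (G : ℝ × ℝ × ℝ × ℝ → ℝ) (hg : ContDiff ℝ 1 G) (p d : ℝ × ℝ × ℝ × ℝ) :
    HasDerivAt (fun s : ℝ => G (p + s • d)) (fderiv ℝ G p d) 0 := by
  have h1 : HasFDerivAt G (fderiv ℝ G p) (p + (0:ℝ) • d) := by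
    simpa using (hg.differentiable one_ne_zero p).hasFDerivAt
  have h2 : HasDerivAt (fun s : ℝ => p + s • d) d 0 := by
    simpa using ((hasDerivAt_id (0:ℝ)).smul_const d).const_add p
  exact h1.comp_hasDerivAt 0 h2

/-- Sufficiency form of Theorem 1: If (i) `(x, v) ↦ g(x, v, a*, t)` is
convex for each `t ∈ [t0, tf]`, (ii) `x*` satisfies the Euler–Lagrange equation at `a*`,
(iii) `a ↦ g(x*(t), x*'(t), a, t)` is concave for each `t ∈ [t0, tf]`, and
(iv) `∫_{t0}^{tf} g_a(x*(t), x*'(t), a*, t) dt = 0`, then `(x*, a*)` is a min-max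
solution of `J`. -/
theorem minmax_sufficient_fixed_endpoints
    (t0 tf x0 xf : ℝ) (ht : t0 < tf)
    (g : ℝ → ℝ → ℝ → ℝ → ℝ)
    (hg : ContDiff ℝ 1 (fun p : ℝ × ℝ × ℝ × ℝ => g p.1 p.2.1 p.2.2.1 p.2.2.2))
    (xs : ℝ → ℝ) (as : ℝ)
    (hxs : ContDiff ℝ 1 xs) (hxs0 : xs t0 = x0) (hxsf : xs tf = xf)
    (hconv : ∀ t ∈ Set.Icc t0 tf,
      ConvexOn ℝ Set.univ (fun p : ℝ × ℝ => g p.1 p.2 as t))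
    (hEL : ∀ t ∈ Set.Icc t0 tf,
      HasDerivAt (fun τ => deriv (fun v => g (xs τ) v as τ) (deriv xs τ))
        (deriv (fun y => g y (deriv xs t) as t) (xs t)) t)
    (hconc : ∀ t ∈ Set.Icc t0 tf,
      ConcaveOn ℝ Set.univ (fun a => g (xs t) (deriv xs t) a t))
    (hstat : (∫ t in t0..tf, deriv (fun b => g (xs t) (deriv xs t) b t) as) = 0) :
    (∀ a : ℝ,
      (∫ t in t0..tf, g (xs t) (deriv xs t) a t) ≤
        ∫ t in t0..tf, g (xs t) (deriv xs t) as t) ∧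
    (∀ x : ℝ → ℝ, ContDiff ℝ 1 x → x t0 = x0 → x tf = xf →
      (∫ t in t0..tf, g (xs t) (deriv xs t) as t) ≤
        ∫ t in t0..tf, g (x t) (deriv x t) as t) := by
  set G : ℝ × ℝ × ℝ × ℝ → ℝ := fun p => g p.1 p.2.1 p.2.2.1 p.2.2.2 with hG
  have hL : Continuous (fderiv ℝ G) := hg.continuous_fderiv one_ne_zero
  have hGd : ∀ p, HasFDerivAt G (fderiv ℝ G p) p := fun p =>
    (hg.differentiable one_ne_zero p).hasFDerivAt
  have hdxs : Continuous (deriv xs) := hxs.continuous_deriv le_rfl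
  have hcxs : Continuous xs := hxs.continuous
  have dx : ∀ x v a t, deriv (fun y => g y v a t) x = fderiv ℝ G (x, v, a, t) (1, 0, 0, 0) := by
    intro x v a t
    exact ((hGd (x, v, a, t)).comp_hasDerivAt x
      ((hasDerivAt_id x).prodMk (hasDerivAt_const x (v, a, t)))).deriv
  have dv : ∀ x v a t, deriv (fun y => g x y a t) v = fderiv ℝ G (x, v, a, t) (0, 1, 0, 0) := by
    intro x v a t
    exact ((hGd (x, v, a, t)).comp_hasDerivAt v
      ((hasDerivAt_const v x).prodMk
        ((hasDerivAt_id v).prodMk (hasDerivAt_const v (a, t))))).deriv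
  have da : ∀ x v a t, deriv (fun y => g x v y t) a = fderiv ℝ G (x, v, a, t) (0, 0, 1, 0) := by
    intro x v a t
    exact ((hGd (x, v, a, t)).comp_hasDerivAt a
      ((hasDerivAt_const a x).prodMk ((hasDerivAt_const a v).prodMk
        ((hasDerivAt_id a).prodMk (hasDerivAt_const a t))))).deriv
  have hcont : ∀ x : ℝ → ℝ, ContDiff ℝ 1 x → ∀ a,
      Continuous (fun t => g (x t) (deriv x t) a t) := by
    intro x hx a
    have h1 : Continuous (deriv x) := hx.continuous_deriv le_rfl
    have h2 : Continuous x := hx.continuous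
    exact hg.continuous.comp (by fun_prop : Continuous fun t => (x t, deriv x t, a, t))
  have hLc : ∀ e, Continuous (fun t => fderiv ℝ G (xs t, deriv xs t, as, t) e) := by
    intro e
    have : Continuous (fun t => fderiv ℝ G (xs t, deriv xs t, as, t)) :=
      hL.comp (by fun_prop : Continuous fun t => (xs t, deriv xs t, as, t))
    exact this.clm_apply continuous_const
  simp only [dx, dv] at hEL
  simp only [da] at hstat
  refine ⟨fun a => ?_, fun x hx hx0 hxf => ?_⟩
  · have key : ∀ t ∈ Set.Icc t0 tf, g (xs t) (deriv xs t) a t ≤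
        g (xs t) (deriv xs t) as t +
          (a - as) * fderiv ℝ G (xs t, deriv xs t, as, t) (0, 0, 1, 0) := by
      intro t ht'
      have h1 := aux_dir G hg (xs t, deriv xs t, as, t) ((a - as) • (0, 0, 1, 0))
      rw [map_smul, smul_eq_mul] at h1
      have h2 := (hconc t ht').neg.comp_affineMap (AffineMap.lineMap as a : ℝ →ᵃ[ℝ] ℝ)
      rw [Set.preimage_univ] at h2
      have h3 := aux_grad _ _ h2 (by
        refine h1.neg.congr_of_eventuallyEq (Filter.Eventually.of_forall fun s => ?_)
        simp [hG, AffineMap.lineMap_apply]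
        congr 1; ring)
      simp at h3
      linarith
    have hc2 : Continuous (fun t =>
        (a - as) * fderiv ℝ G (xs t, deriv xs t, as, t) (0, 0, 1, 0)) :=
      continuous_const.mul (hLc _)
    calc _ ≤ ∫ t in t0..tf, (g (xs t) (deriv xs t) as t +
          (a - as) * fderiv ℝ G (xs t, deriv xs t, as, t) (0, 0, 1, 0)) := by
          apply intervalIntegral.integral_mono_on ht.le
            ((hcont xs hxs a).intervalIntegrable _ _) _ key
          exact ((hcont xs hxs as).add hc2).intervalIntegrable _ _
      _ = _ := by
          rw [intervalIntegral.integral_add ((hcont xs hxs as).intervalIntegrable _ _)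
            (hc2.intervalIntegrable _ _),
            intervalIntegral.integral_const_mul, hstat]
          simp
  · have hdx : Continuous (deriv x) := hx.continuous_deriv le_rfl
    have hcx : Continuous x := hx.continuous
    set R : ℝ → ℝ := fun t =>
      fderiv ℝ G (xs t, deriv xs t, as, t) (1, 0, 0, 0) * (x t - xs t) +
      fderiv ℝ G (xs t, deriv xs t, as, t) (0, 1, 0, 0) * (deriv x t - deriv xs t) with hR
    have hRc : Continuous R :=
      ((hLc _).mul (hcx.sub hcxs)).add ((hLc _).mul (hdx.sub hdxs))
    have hR0 : ∫ t in t0..tf, R t = 0 := by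
      rw [intervalIntegral.integral_eq_sub_of_hasDerivAt
        (f := fun t => fderiv ℝ G (xs t, deriv xs t, as, t) (0, 1, 0, 0) * (x t - xs t))]
      · simp [hx0, hxf, hxs0, hxsf]
      · intro t ht'
        rw [Set.uIcc_of_le ht.le] at ht'
        exact (hEL t ht').mul (((hx.differentiable one_ne_zero t).hasDerivAt).sub
          ((hxs.differentiable one_ne_zero t).hasDerivAt))
      · exact hRc.intervalIntegrable _ _
    have key : ∀ t ∈ Set.Icc t0 tf,
        g (xs t) (deriv xs t) as t + R t ≤ g (x t) (deriv x t) as t := by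
      intro t ht'
      have h1 := aux_dir G hg (xs t, deriv xs t, as, t)
        ((x t - xs t) • (1, 0, 0, 0) + (deriv x t - deriv xs t) • (0, 1, 0, 0))
      rw [map_add, map_smul, map_smul, smul_eq_mul, smul_eq_mul] at h1
      have h2 := (hconv t ht').comp_affineMap
        (AffineMap.lineMap (xs t, deriv xs t) (x t, deriv x t) : ℝ →ᵃ[ℝ] ℝ × ℝ)
      rw [Set.preimage_univ] at h2
      have h3 := aux_grad _ _ h2 (by
        convert h1 using 1
        funext s
        simp [hG, AffineMap.lineMap_apply]
        congr 1 <;> ring)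
      simp at h3
      simp only [hR]
      linarith
    calc _ = ∫ t in t0..tf, (g (xs t) (deriv xs t) as t + R t) := by
          rw [intervalIntegral.integral_add ((hcont xs hxs as).intervalIntegrable _ _)
            (hRc.intervalIntegrable _ _), hR0, add_zero]
      _ ≤ _ := intervalIntegral.integral_mono_on ht.le
            (((hcont xs hxs as).add hRc).intervalIntegrable _ _)
            ((hcont x hx as).intervalIntegrable _ _) key
end

section
/- (Theorem 2, necessary conditions: specified final time, free final point.) Suppose (x*, a*) is a min-max solution of J over the free-endpoint class. Then: (a) x* satisfies the Euler–Lagrange equation in integrated form, i.e. there exists c ∈ ℝ with (∂g/∂v)(x*(t), x*'(t), a*, t) = c + ∫_{t0}^{t} (∂g/∂x)(x*(s), x*'(s), a*, s) ds for all t ∈ [t0, tf]; (b) the natural boundary condition holds: (∂g/∂v)(x*(tf), x*'(tf), a*, tf) = 0; and (c) ∫_{t0}^{tf} (∂g/∂a)(x*(t), x*'(t), a*, t) dt = 0. -/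
theorem aux_param (a b : ℝ) (F F' : ℝ → ℝ → ℝ) (x₀ : ℝ)
    (hF : Continuous (fun p : ℝ × ℝ => F p.1 p.2))
    (hF' : Continuous (fun p : ℝ × ℝ => F' p.1 p.2))
    (hd : ∀ x t, HasDerivAt (fun x => F x t) (F' x t) x) :
    HasDerivAt (fun x => ∫ t in a..b, F x t) (∫ t in a..b, F' x₀ t) x₀ := by
  have hc : ∀ x, Continuous (F x) := fun x => hF.comp (by fun_prop : Continuous fun t => (x, t))
  have hc' : ∀ x, Continuous (F' x) := fun x => hF'.comp (by fun_prop : Continuous fun t => (x, t))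
  obtain ⟨C, hC⟩ := ((isCompact_closedBall x₀ 1).prod (isCompact_uIcc (a := a) (b := b))).exists_bound_of_continuousOn
    hF'.continuousOn
  refine (intervalIntegral.hasDerivAt_integral_of_dominated_loc_of_deriv_le
    (F := F) (F' := F') (bound := fun _ => C) (Metric.closedBall_mem_nhds x₀ one_pos)
    (Filter.Eventually.of_forall fun x => (hc x).aestronglyMeasurable)
    ((hc x₀).intervalIntegrable _ _) (hc' x₀).aestronglyMeasurable ?_ (by simp) ?_).2
  · exact Filter.Eventually.of_forall fun t ht x hx => hC (x, t) ⟨hx, Set.uIoc_subset_uIcc ht⟩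
  · exact Filter.Eventually.of_forall fun t ht x hx => hd x t

theorem aux_fund (t0 tf : ℝ) (ht : t0 < tf) (p q : ℝ → ℝ) (hp : Continuous p) (hq : Continuous q)
    (hvar : ∀ η : ℝ → ℝ, ContDiff ℝ 1 η → η t0 = 0 →
      (∫ t in t0..tf, (p t * η t + q t * deriv η t)) = 0) :
    (∃ c : ℝ, ∀ t ∈ Set.Icc t0 tf, q t = c + ∫ s in t0..t, p s) ∧ q tf = 0 := by
  have hPd : ∀ t, HasDerivAt (fun t => ∫ s in t0..t, p s) (p t) t := fun t =>
    hp.integral_hasStrictDerivAt t0 t |>.hasDerivAt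
  obtain ⟨P, hP⟩ : ∃ P : ℝ → ℝ, P = fun t => ∫ s in t0..t, p s := ⟨_, rfl⟩
  rw [← hP] at hPd
  have hPc : Continuous P := continuous_iff_continuousAt.2 fun t => (hPd t).continuousAt
  obtain ⟨w, hw⟩ : ∃ w : ℝ → ℝ, w = fun t => q t - P t + P tf := ⟨_, rfl⟩
  have hwc : Continuous w := by rw [hw]; fun_prop
  obtain ⟨η, hη⟩ : ∃ η : ℝ → ℝ, η = fun t => ∫ s in t0..t, w s := ⟨_, rfl⟩
  have hηd : ∀ t, HasDerivAt η (w t) t := fun t => by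
    rw [hη]; exact hwc.integral_hasStrictDerivAt t0 t |>.hasDerivAt
  have hη' : deriv η = w := funext fun t => (hηd t).deriv
  have hηc : Continuous η := continuous_iff_continuousAt.2 fun t => (hηd t).continuousAt
  have hη1 : ContDiff ℝ 1 η := contDiff_one_iff_deriv.2
    ⟨fun t => (hηd t).differentiableAt, hη' ▸ hwc⟩
  have hη0 : η t0 = 0 := by simp [hη]
  have h1 := hvar η hη1 hη0
  rw [hη'] at h1
  have h2 : (∫ t in t0..tf, (p t * η t + (P t - P tf) * w t)) =
      (P tf - P tf) * η tf - (P t0 - P tf) * η t0 :=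
    intervalIntegral.integral_eq_sub_of_hasDerivAt (f := fun t => (P t - P tf) * η t)
      (fun t _ => ((hPd t).sub_const (P tf)).mul (hηd t))
      (Continuous.intervalIntegrable (by fun_prop) _ _)
  have h3 : (∫ t in t0..tf, w t ^ 2) = 0 := by
    have h4 : (∫ t in t0..tf, w t ^ 2) = (∫ t in t0..tf, (p t * η t + q t * w t)) -
        ∫ t in t0..tf, (p t * η t + (P t - P tf) * w t) := by
      rw [← intervalIntegral.integral_sub (Continuous.intervalIntegrable (by fun_prop) _ _)
        (Continuous.intervalIntegrable (by fun_prop) _ _)]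
      congr 1
      ext t
      simp only [hw]
      ring
    rw [h4, h1, h2, hη0]
    ring
  have hw0 : ∀ t ∈ Set.Icc t0 tf, w t = 0 := by
    intro t htt
    by_contra hne
    have := intervalIntegral.integral_pos ht (f := fun t => w t ^ 2)
      (Continuous.continuousOn (by fun_prop)) (fun _ _ => sq_nonneg _) ⟨t, htt, by positivity⟩
    linarith
  refine ⟨⟨-P tf, fun t htt => ?_⟩, ?_⟩
  · have h5 := hw0 t htt
    have h6 : P t = ∫ s in t0..t, p s := by rw [hP]
    rw [← h6]
    simp only [hw] at h5
    linarith
  · have h5 := hw0 tf ⟨ht.le, le_rfl⟩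
    simp only [hw] at h5
    linarith


/-- Theorem 2, necessary conditions: specified final time, free final
point: If `(x*, a*)` is a min-max solution of `J` over the free-endpoint class, then
(a) `x*` satisfies the Euler–Lagrange equation in integrated form, (b) the natural
boundary condition `g_v(x*(tf), x*'(tf), a*, tf) = 0` holds, and
(c) `∫_{t0}^{tf} g_a(x*(t), x*'(t), a*, t) dt = 0`. -/
theorem necessary_conditions_free_final_point
    (t0 tf x0 : ℝ) (ht : t0 < tf)
    (g : ℝ → ℝ → ℝ → ℝ → ℝ)
    (hg : ContDiff ℝ 1 (fun p : ℝ × ℝ × ℝ × ℝ => g p.1 p.2.1 p.2.2.1 p.2.2.2))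
    (xs : ℝ → ℝ) (as : ℝ)
    (hxs : ContDiff ℝ 1 xs) (hxs0 : xs t0 = x0)
    (hmax : ∀ a : ℝ,
      (∫ t in t0..tf, g (xs t) (deriv xs t) a t) ≤
        ∫ t in t0..tf, g (xs t) (deriv xs t) as t)
    (hmin : ∀ x : ℝ → ℝ, ContDiff ℝ 1 x → x t0 = x0 →
      (∫ t in t0..tf, g (xs t) (deriv xs t) as t) ≤
        ∫ t in t0..tf, g (x t) (deriv x t) as t) :
    (∃ c : ℝ, ∀ t ∈ Set.Icc t0 tf,
      deriv (fun v => g (xs t) v as t) (deriv xs t) =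
        c + ∫ s in t0..t, deriv (fun y => g y (deriv xs s) as s) (xs s)) ∧
    deriv (fun v => g (xs tf) v as tf) (deriv xs tf) = 0 ∧
    (∫ t in t0..tf, deriv (fun b => g (xs t) (deriv xs t) b t) as) = 0 := by
  set G : ℝ × ℝ × ℝ × ℝ → ℝ := fun p => g p.1 p.2.1 p.2.2.1 p.2.2.2 with hG
  have hGd : ∀ p, HasFDerivAt G (fderiv ℝ G p) p := fun p =>
    ((hg.differentiable one_ne_zero) p).hasFDerivAt
  have hGc : Continuous (fderiv ℝ G) := hg.continuous_fderiv one_ne_zero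
  have hxc : Continuous xs := hxs.continuous
  have hxc' : Continuous (deriv xs) := hxs.continuous_deriv le_rfl
  have key : ∀ (u u' v v' w w' : ℝ → ℝ) (t e : ℝ), HasDerivAt u (u' e) e → HasDerivAt v (v' e) e →
      HasDerivAt w (w' e) e → HasDerivAt (fun e => g (u e) (v e) (w e) t)
        (fderiv ℝ G (u e, v e, w e, t) (u' e, v' e, w' e, 0)) e := by
    intro u u' v v' w w' t e hu hv hw
    exact (hGd (u e, v e, w e, t)).comp_hasDerivAt e
      (hu.prodMk (hv.prodMk (hw.prodMk (hasDerivAt_const e t))))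
  have hderx : ∀ t, deriv (fun y => g y (deriv xs t) as t) (xs t) =
      fderiv ℝ G (xs t, deriv xs t, as, t) (1, 0, 0, 0) := fun t =>
    (key (fun y => y) (fun _ => 1) (fun _ => deriv xs t) (fun _ => 0) (fun _ => as) (fun _ => 0) t (xs t)
      (hasDerivAt_id _) (hasDerivAt_const _ _) (hasDerivAt_const _ _)).deriv
  have hderv : ∀ t, deriv (fun v => g (xs t) v as t) (deriv xs t) =
      fderiv ℝ G (xs t, deriv xs t, as, t) (0, 1, 0, 0) := fun t =>
    (key (fun _ => xs t) (fun _ => 0) (fun y => y) (fun _ => 1) (fun _ => as) (fun _ => 0) t (deriv xs t)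
      (hasDerivAt_const _ _) (hasDerivAt_id _) (hasDerivAt_const _ _)).deriv
  have hdera : ∀ t, deriv (fun b => g (xs t) (deriv xs t) b t) as =
      fderiv ℝ G (xs t, deriv xs t, as, t) (0, 0, 1, 0) := fun t =>
    (key (fun _ => xs t) (fun _ => 0) (fun _ => deriv xs t) (fun _ => 0) (fun y => y) (fun _ => 1) t as
      (hasDerivAt_const _ _) (hasDerivAt_const _ _) (hasDerivAt_id _)).deriv
  simp only [hderx, hderv, hdera]
  have hGC : Continuous G := hg.continuous
  have hpc : Continuous (fun t => fderiv ℝ G (xs t, deriv xs t, as, t) (1, 0, 0, 0)) := by fun_prop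
  have hqc : Continuous (fun t => fderiv ℝ G (xs t, deriv xs t, as, t) (0, 1, 0, 0)) := by fun_prop
  have hc : (∫ t in t0..tf, fderiv ℝ G (xs t, deriv xs t, as, t) (0, 0, 1, 0)) = 0 := by
    have h1 := aux_param t0 tf (fun b t => g (xs t) (deriv xs t) b t)
      (fun b t => fderiv ℝ G (xs t, deriv xs t, b, t) (0, 0, 1, 0)) as
      (hGC.comp (by fun_prop : Continuous fun p : ℝ × ℝ => (xs p.2, deriv xs p.2, p.1, p.2)))
      (by fun_prop) (fun b t => key (fun _ => xs t) (fun _ => 0) (fun _ => deriv xs t) (fun _ => 0)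
        (fun y => y) (fun _ => 1) t b
        (hasDerivAt_const _ _) (hasDerivAt_const _ _) (hasDerivAt_id _))
    exact IsLocalMax.hasDerivAt_eq_zero (Filter.Eventually.of_forall hmax) h1
  have hvar : ∀ η : ℝ → ℝ, ContDiff ℝ 1 η → η t0 = 0 →
      (∫ t in t0..tf, (fderiv ℝ G (xs t, deriv xs t, as, t) (1, 0, 0, 0) * η t +
        fderiv ℝ G (xs t, deriv xs t, as, t) (0, 1, 0, 0) * deriv η t)) = 0 := by
    intro η hη hη0
    have hηc : Continuous η := hη.continuous
    have hηc' : Continuous (deriv η) := hη.continuous_deriv le_rfl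
    have h1 := aux_param t0 tf (fun e t => g (xs t + e * η t) (deriv xs t + e * deriv η t) as t)
      (fun e t => fderiv ℝ G (xs t + e * η t, deriv xs t + e * deriv η t, as, t)
        (η t, deriv η t, 0, 0)) 0
      (hGC.comp (by fun_prop : Continuous fun p : ℝ × ℝ =>
        (xs p.2 + p.1 * η p.2, deriv xs p.2 + p.1 * deriv η p.2, as, p.2)))
      (by fun_prop) (fun e t => key (fun e => xs t + e * η t) (fun _ => η t)
        (fun e => deriv xs t + e * deriv η t) (fun _ => deriv η t)
        (fun _ => as) (fun _ => 0) t e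
        (by simpa using ((hasDerivAt_id e).mul_const (η t)).const_add (xs t))
        (by simpa using ((hasDerivAt_id e).mul_const (deriv η t)).const_add (deriv xs t))
        (hasDerivAt_const _ _))
    have h2 : IsLocalMin (fun e => ∫ t in t0..tf,
        g (xs t + e * η t) (deriv xs t + e * deriv η t) as t) 0 := by
      refine Filter.Eventually.of_forall fun e => ?_
      have h3 := hmin (fun t => xs t + e * η t) (hxs.add (contDiff_const.mul hη)) (by simp [hη0, hxs0])
      have h4 : ∀ t, deriv (fun t => xs t + e * η t) t = deriv xs t + e * deriv η t := fun t =>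
        (((hxs.differentiable one_ne_zero) t).hasDerivAt.add
          (((hη.differentiable one_ne_zero) t).hasDerivAt.const_mul e)).deriv
      simp only [h4] at h3
      simpa using h3
    have h5 := h2.hasDerivAt_eq_zero h1
    refine Eq.trans ?_ h5
    congr 1
    ext t
    have h6 : ((η t, deriv η t, 0, 0) : ℝ × ℝ × ℝ × ℝ) =
      η t • (1, 0, 0, 0) + deriv η t • (0, 1, 0, 0) := by simp
    rw [h6, map_add, map_smul, map_smul]
    simp [mul_comm]
  obtain ⟨h1, h2⟩ := aux_fund t0 tf ht _ _ hpc hqc hvar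
  exact ⟨h1, h2, hc⟩
end

section
/- (Sufficiency form of Theorem 2: specified final time, free final point.) Let x* be admissible in the free-endpoint class and a* ∈ ℝ. Assume: (i) for each t ∈ [t0, tf] the map (x, v) ↦ g(x, v, a*, t) is convex on ℝ × ℝ; (ii) the function t ↦ (∂g/∂v)(x*(t), x*'(t), a*, t) is differentiable on [t0, tf] with derivative (∂g/∂x)(x*(t), x*'(t), a*, t); (iii) the natural boundary condition (∂g/∂v)(x*(tf), x*'(tf), a*, tf) = 0 holds; (iv) for each t ∈ [t0, tf] the map a ↦ g(x*(t), x*'(t), a, t) is concave on ℝ; (v) ∫_{t0}^{tf} (∂g/∂a)(x*(t), x*'(t), a*, t) dt = 0. Then (x*, a*) is a min-max solution over the free-endpoint class: J(x*, a) ≤ J(x*, a*) ≤ J(x, a*) for every a ∈ ℝ and every admissible x. -/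
theorem aux_grad_s7 {E : Type*} [NormedAddCommGroup E] [NormedSpace ℝ E] {f : E → ℝ}
    {f' : E →L[ℝ] ℝ} {x : E} (hf : ConvexOn ℝ Set.univ f) (h : HasFDerivAt f f' x) (y : E) :
    f x + f' (y - x) ≤ f y := by
  have h1 : ConvexOn ℝ Set.univ (fun s : ℝ => f (AffineMap.lineMap x y s)) := by
    have h0 := hf.comp_affineMap (AffineMap.lineMap x y : ℝ →ᵃ[ℝ] E)
    rw [Set.preimage_univ] at h0
    exact h0
  have h2 : HasDerivAt (fun s : ℝ => f (AffineMap.lineMap x y s)) (f' (y - x)) 0 := by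
    have h3 : HasDerivAt (fun s : ℝ => (AffineMap.lineMap x y s : E)) (y - x) 0 :=
      AffineMap.hasDerivAt_lineMap
    have h4 : HasFDerivAt f f' (AffineMap.lineMap x y (0 : ℝ)) := by simpa using h
    exact h4.comp_hasDerivAt (0 : ℝ) h3
  have h5 := h1.le_slope_of_hasDerivAt (Set.mem_univ 0) (Set.mem_univ 1) one_pos h2
  simp [slope_def_field] at h5
  rw [map_sub]
  linarith

/-- Sufficiency form of Theorem 2: specified final time, free final
point: Under (i) convexity of `(x, v) ↦ g(x, v, a*, t)`, (ii) the Euler–Lagrange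
equation along `x*`, (iii) the natural boundary condition at `tf`, (iv) concavity of
`a ↦ g(x*(t), x*'(t), a, t)`, and (v) stationarity in the parameter, the pair
`(x*, a*)` is a min-max solution over the free-endpoint class. -/
theorem minmax_sufficient_free_final_point
    (t0 tf x0 : ℝ) (ht : t0 < tf)
    (g : ℝ → ℝ → ℝ → ℝ → ℝ)
    (hg : ContDiff ℝ 1 (fun p : ℝ × ℝ × ℝ × ℝ => g p.1 p.2.1 p.2.2.1 p.2.2.2))
    (xs : ℝ → ℝ) (as : ℝ)
    (hxs : ContDiff ℝ 1 xs) (hxs0 : xs t0 = x0)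
    (hconv : ∀ t ∈ Set.Icc t0 tf,
      ConvexOn ℝ Set.univ (fun p : ℝ × ℝ => g p.1 p.2 as t))
    (hEL : ∀ t ∈ Set.Icc t0 tf,
      HasDerivAt (fun τ => deriv (fun v => g (xs τ) v as τ) (deriv xs τ))
        (deriv (fun y => g y (deriv xs t) as t) (xs t)) t)
    (hnbc : deriv (fun v => g (xs tf) v as tf) (deriv xs tf) = 0)
    (hconc : ∀ t ∈ Set.Icc t0 tf,
      ConcaveOn ℝ Set.univ (fun a => g (xs t) (deriv xs t) a t))
    (hstat : (∫ t in t0..tf, deriv (fun b => g (xs t) (deriv xs t) b t) as) = 0) :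
    (∀ a : ℝ,
      (∫ t in t0..tf, g (xs t) (deriv xs t) a t) ≤
        ∫ t in t0..tf, g (xs t) (deriv xs t) as t) ∧
    (∀ x : ℝ → ℝ, ContDiff ℝ 1 x → x t0 = x0 →
      (∫ t in t0..tf, g (xs t) (deriv xs t) as t) ≤
        ∫ t in t0..tf, g (x t) (deriv x t) as t) := by
  set G : ℝ × ℝ × ℝ × ℝ → ℝ := fun p => g p.1 p.2.1 p.2.2.1 p.2.2.2 with hG
  have hD : ∀ p, HasFDerivAt G (fderiv ℝ G p) p := fun p =>
    ((hg.differentiable one_ne_zero) p).hasFDerivAt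
  have hfc : Continuous (fderiv ℝ G) := hg.continuous_fderiv one_ne_zero
  have hxc := hxs.continuous
  have hdc : Continuous (deriv xs) := hxs.continuous_deriv le_rfl
  have hGc : Continuous G := hg.continuous
  have hx1 : ∀ x v a t, HasDerivAt (fun y => g y v a t)
      (fderiv ℝ G (x, v, a, t) (1, 0, 0, 0)) x := fun x v a t =>
    (hD (x, v, a, t)).comp_hasDerivAt x (f := fun y => (y, v, a, t))
      ((hasDerivAt_id x).prodMk (hasDerivAt_const x (v, a, t)))
  have hv1 : ∀ x v a t, HasDerivAt (fun y => g x y a t)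
      (fderiv ℝ G (x, v, a, t) (0, 1, 0, 0)) v := fun x v a t =>
    (hD (x, v, a, t)).comp_hasDerivAt v (f := fun y => (x, y, a, t))
      ((hasDerivAt_const v x).prodMk ((hasDerivAt_id v).prodMk (hasDerivAt_const v (a, t))))
  have ha1 : ∀ x v a t, HasDerivAt (fun y => g x v y t)
      (fderiv ℝ G (x, v, a, t) (0, 0, 1, 0)) a := fun x v a t =>
    (hD (x, v, a, t)).comp_hasDerivAt a (f := fun y => (x, v, y, t))
      ((hasDerivAt_const a x).prodMk ((hasDerivAt_const a v).prodMk
        ((hasDerivAt_id a).prodMk (hasDerivAt_const a t))))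
  have hxv : ∀ x v a t, HasFDerivAt (fun p : ℝ × ℝ => g p.1 p.2 a t)
      ((fderiv ℝ G (x, v, a, t)).comp ((ContinuousLinearMap.fst ℝ ℝ ℝ).prod
        ((ContinuousLinearMap.snd ℝ ℝ ℝ).prod (0 : ℝ × ℝ →L[ℝ] ℝ × ℝ)))) (x, v) :=
    fun x v a t =>
    (hD (x, v, a, t)).comp (x, v) (f := fun p : ℝ × ℝ => (p.1, p.2, a, t))
      (hasFDerivAt_fst.prodMk (hasFDerivAt_snd.prodMk (hasFDerivAt_const (a, t) (x, v))))
  have hcg : ∀ (x y : ℝ → ℝ) (a : ℝ), Continuous x → Continuous y →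
      Continuous (fun t => g (x t) (y t) a t) := fun x y a hx hy =>
    hGc.comp (hx.prodMk (hy.prodMk (continuous_const.prodMk continuous_id)))
  have hcp : ∀ e, Continuous (fun t => fderiv ℝ G (xs t, deriv xs t, as, t) e) := fun e =>
    (hfc.comp (hxc.prodMk (hdc.prodMk (continuous_const.prodMk continuous_id)))).clm_apply
      continuous_const
  simp only [(hx1 _ _ _ _).deriv, (hv1 _ _ _ _).deriv] at hEL
  simp only [(hv1 _ _ _ _).deriv] at hnbc
  simp only [(ha1 _ _ _ _).deriv] at hstat
  constructor
  · intro a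
    have key : (∫ t in t0..tf, g (xs t) (deriv xs t) a t) ≤
        ∫ t in t0..tf, (g (xs t) (deriv xs t) as t +
          (a - as) * fderiv ℝ G (xs t, deriv xs t, as, t) (0, 0, 1, 0)) := by
      apply intervalIntegral.integral_mono_on ht.le
      · exact (hcg _ _ _ hxc hdc).intervalIntegrable _ _
      · exact ((hcg _ _ _ hxc hdc).add (continuous_const.mul (hcp _))).intervalIntegrable _ _
      · intro t htt
        have := aux_grad_s7 (hconc t htt).neg (ha1 (xs t) (deriv xs t) as t).neg.hasFDerivAt a
        simp at this
        linarith
    rw [intervalIntegral.integral_add ((hcg _ _ _ hxc hdc).intervalIntegrable _ _)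
      (((hcp _).intervalIntegrable _ _).const_mul _),
      intervalIntegral.integral_const_mul, hstat] at key
    simpa using key
  · intro x hx hx0
    have hxc' := hx.continuous
    have hdc' : Continuous (deriv x) := hx.continuous_deriv le_rfl
    have hcr : Continuous (fun t =>
        fderiv ℝ G (xs t, deriv xs t, as, t) (1, 0, 0, 0) * (x t - xs t) +
        fderiv ℝ G (xs t, deriv xs t, as, t) (0, 1, 0, 0) * (deriv x t - deriv xs t)) :=
      ((hcp _).mul (hxc'.sub hxc)).add ((hcp _).mul (hdc'.sub hdc))
    have h0 : ∫ t in t0..tf, (fderiv ℝ G (xs t, deriv xs t, as, t) (1, 0, 0, 0) * (x t - xs t) +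
        fderiv ℝ G (xs t, deriv xs t, as, t) (0, 1, 0, 0) * (deriv x t - deriv xs t)) = 0 := by
      rw [intervalIntegral.integral_eq_sub_of_hasDerivAt
        (f := fun t => fderiv ℝ G (xs t, deriv xs t, as, t) (0, 1, 0, 0) * (x t - xs t)) _
        (hcr.intervalIntegrable _ _)]
      · simp [hnbc, hx0, hxs0]
      · intro t htt
        rw [Set.uIcc_of_le ht.le] at htt
        exact (hEL t htt).mul (((hx.differentiable one_ne_zero) t).hasDerivAt.sub
          ((hxs.differentiable one_ne_zero) t).hasDerivAt)
    have key : (∫ t in t0..tf, (g (xs t) (deriv xs t) as t +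
        (fderiv ℝ G (xs t, deriv xs t, as, t) (1, 0, 0, 0) * (x t - xs t) +
        fderiv ℝ G (xs t, deriv xs t, as, t) (0, 1, 0, 0) * (deriv x t - deriv xs t)))) ≤
        ∫ t in t0..tf, g (x t) (deriv x t) as t := by
      apply intervalIntegral.integral_mono_on ht.le
      · exact ((hcg _ _ _ hxc hdc).add hcr).intervalIntegrable _ _
      · exact (hcg _ _ _ hxc' hdc').intervalIntegrable _ _
      · intro t htt
        have h1 := aux_grad_s7 (hconv t htt) (hxv (xs t) (deriv xs t) as t) (x t, deriv x t)
        have h2 : ((x t - xs t, deriv x t - deriv xs t, 0) : ℝ × ℝ × ℝ × ℝ) =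
            (x t - xs t) • ((1, 0, 0, 0) : ℝ × ℝ × ℝ × ℝ) +
            (deriv x t - deriv xs t) • ((0, 1, 0, 0) : ℝ × ℝ × ℝ × ℝ) := by
          ext <;> simp
        have h3 : g (xs t) (deriv xs t) as t + fderiv ℝ G (xs t, deriv xs t, as, t)
          (x t - xs t, deriv x t - deriv xs t, 0) ≤ g (x t) (deriv x t) as t := h1
        rw [h2, map_add, map_smul, map_smul, smul_eq_mul, smul_eq_mul] at h3
        linarith
    rw [intervalIntegral.integral_add ((hcg _ _ _ hxc hdc).intervalIntegrable _ _)
      (hcr.intervalIntegrable _ _), h0, add_zero] at key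
    exact key
end

section
/- (Theorem 4, necessary conditions: free final time and free final point.) Let x* : ℝ → ℝ be continuously differentiable, tf* > t0, x*(t0) = x0, and let a* ∈ ℝ. Suppose (x*, tf*) minimizes the free-time functional at a* over all curves and final times: for every T > t0 and every continuously differentiable y : ℝ → ℝ with y(t0) = x0, ∫_{t0}^{T} g(y(t), y'(t), a*, t) dt ≥ ∫_{t0}^{tf*} g(x*(t), x*'(t), a*, t) dt. Then: (a) x* satisfies the Euler–Lagrange equation in integrated form on [t0, tf*], i.e. there exists c ∈ ℝ with (∂g/∂v)(x*(t), x*'(t), a*, t) = c + ∫_{t0}^{t} (∂g/∂x)(x*(s), x*'(s), a*, s) ds for all t ∈ [t0, tf*]; (b) (∂g/∂v)(x*(tf*), x*'(tf*), a*, tf*) = 0; and (c) g(x*(tf*), x*'(tf*), a*, tf*) = 0. -/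
open Set Filter Topology MeasureTheory in
lemma aux_leibniz (F F' : ℝ → ℝ → ℝ) (a b : ℝ)
    (hF : Continuous (fun p : ℝ × ℝ => F p.1 p.2))
    (hF' : Continuous (fun p : ℝ × ℝ => F' p.1 p.2))
    (hd : ∀ e t, HasDerivAt (fun e => F e t) (F' e t) e) :
    HasDerivAt (fun e => ∫ t in a..b, F e t) (∫ t in a..b, F' 0 t) 0 := by
  have hc : ∀ e, Continuous (F e) := fun e => hF.comp (by fun_prop : Continuous fun t => (e, t))
  have hc' : ∀ e, Continuous (F' e) := fun e => hF'.comp (by fun_prop : Continuous fun t => (e, t))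
  obtain ⟨C, hC⟩ := ((isCompact_Icc (a := (-1:ℝ)) (b := 1)).prod
    (isCompact_uIcc (a := a) (b := b))).exists_bound_of_continuousOn hF'.continuousOn
  refine (intervalIntegral.hasDerivAt_integral_of_dominated_loc_of_deriv_le (μ := volume)
    (s := Icc (-1) 1) (bound := fun _ => C) (Icc_mem_nhds (by norm_num) (by norm_num))
    (Eventually.of_forall fun e => (hc e).aestronglyMeasurable)
    ((hc 0).intervalIntegrable _ _) (hc' 0).aestronglyMeasurable ?_
    intervalIntegrable_const ?_).2
  · exact Eventually.of_forall fun t ht e he => hC (e, t) ⟨he, uIoc_subset_uIcc ht⟩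
  · exact Eventually.of_forall fun t _ e _ => hd e t

/-- Theorem 4, necessary conditions: free final time and free final
point: If `(x*, tf*)` minimizes the free-time functional at `a*` over all curves with
`y(t0) = x0` and all final times, then (a) `x*` satisfies the Euler–Lagrange equation
in integrated form on `[t0, tf*]`, (b) `g_v(x*(tf*), x*'(tf*), a*, tf*) = 0`, and
(c) `g(x*(tf*), x*'(tf*), a*, tf*) = 0`. -/
theorem necessary_conditions_free_final_time_and_point
    (t0 x0 : ℝ)
    (g : ℝ → ℝ → ℝ → ℝ → ℝ)
    (hg : ContDiff ℝ 1 (fun p : ℝ × ℝ × ℝ × ℝ => g p.1 p.2.1 p.2.2.1 p.2.2.2))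
    (xs : ℝ → ℝ) (tfs : ℝ) (as : ℝ)
    (hxs : ContDiff ℝ 1 xs) (htfs : t0 < tfs)
    (hxs0 : xs t0 = x0)
    (hmin : ∀ T : ℝ, t0 < T → ∀ y : ℝ → ℝ, ContDiff ℝ 1 y → y t0 = x0 →
      (∫ t in t0..tfs, g (xs t) (deriv xs t) as t) ≤
        ∫ t in t0..T, g (y t) (deriv y t) as t) :
    (∃ c : ℝ, ∀ t ∈ Set.Icc t0 tfs,
      deriv (fun v => g (xs t) v as t) (deriv xs t) =
        c + ∫ s in t0..t, deriv (fun y => g y (deriv xs s) as s) (xs s)) ∧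
    deriv (fun v => g (xs tfs) v as tfs) (deriv xs tfs) = 0 ∧
    g (xs tfs) (deriv xs tfs) as tfs = 0 := by
  set G : ℝ × ℝ × ℝ × ℝ → ℝ := fun p => g p.1 p.2.1 p.2.2.1 p.2.2.2 with hG
  have hGc : Continuous G := hg.continuous
  have hGd : ∀ p, HasFDerivAt G (fderiv ℝ G p) p := fun p =>
    (hg.differentiable (by norm_num) p).hasFDerivAt
  have hGf : Continuous (fderiv ℝ G) := hg.continuous_fderiv (by norm_num)
  have hx : Continuous xs := hxs.continuous
  have hx' : Continuous (deriv xs) := hxs.continuous_deriv (by norm_num)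
  have hxd : ∀ t, HasDerivAt xs (deriv xs t) t := fun t =>
    (hxs.differentiable (by norm_num) t).hasDerivAt
  let q : ℝ → ℝ × ℝ × ℝ × ℝ := fun t => (xs t, deriv xs t, as, t)
  have hq : Continuous q := by fun_prop
  let A : ℝ → ℝ := fun t => fderiv ℝ G (q t) (1, 0, 0, 0)
  let B : ℝ → ℝ := fun t => fderiv ℝ G (q t) (0, 1, 0, 0)
  have hA : Continuous A := (hGf.comp hq).clm_apply continuous_const
  have hB : Continuous B := (hGf.comp hq).clm_apply continuous_const
  have eA : ∀ t, deriv (fun y => g y (deriv xs t) as t) (xs t) = A t := by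
    intro t
    have h1 : HasDerivAt (fun y : ℝ => (y, deriv xs t, as, t)) ((1 : ℝ), (0 : ℝ), (0 : ℝ), (0 : ℝ)) (xs t) :=
      (hasDerivAt_id _).prodMk (hasDerivAt_const _ _)
    exact ((hGd (q t)).comp_hasDerivAt (xs t) h1).deriv
  have eB : ∀ t, deriv (fun v => g (xs t) v as t) (deriv xs t) = B t := by
    intro t
    have h1 : HasDerivAt (fun v : ℝ => (xs t, v, as, t)) ((0 : ℝ), (1 : ℝ), (0 : ℝ), (0 : ℝ)) (deriv xs t) :=
      (hasDerivAt_const _ _).prodMk ((hasDerivAt_id _).prodMk (hasDerivAt_const _ _))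
    exact ((hGd (q t)).comp_hasDerivAt (deriv xs t) h1).deriv
  let Q : ℝ → ℝ := fun t => ∫ s in tfs..t, A s
  have hQd : ∀ t, HasDerivAt Q (A t) t := fun t => (hA.integral_hasStrictDerivAt tfs t).hasDerivAt
  have hQ : Continuous Q := continuous_iff_continuousAt.2 fun t => (hQd t).continuousAt
  let u : ℝ → ℝ := fun t => B t - Q t
  have hu : Continuous u := hB.sub hQ
  let h : ℝ → ℝ := fun t => ∫ s in t0..t, u s
  have hhd : ∀ t, HasDerivAt h (u t) t := fun t => (hu.integral_hasStrictDerivAt t0 t).hasDerivAt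
  have hh : Continuous h := continuous_iff_continuousAt.2 fun t => (hhd t).continuousAt
  have hQ0 : Q tfs = 0 := intervalIntegral.integral_same
  have hh0 : h t0 = 0 := intervalIntegral.integral_same
  have hparts : ∫ t in t0..tfs, (A t * h t + Q t * u t) = 0 := by
    rw [intervalIntegral.integral_deriv_mul_eq_sub (fun t _ => hQd t) (fun t _ => hhd t)
      (hA.intervalIntegrable _ _) (hu.intervalIntegrable _ _), hQ0, hh0]
    ring
  let r : ℝ → ℝ → ℝ × ℝ × ℝ × ℝ := fun e t => (xs t + e * h t, deriv xs t + e * u t, as, t)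
  have hr : Continuous (fun p : ℝ × ℝ => r p.1 p.2) := by fun_prop
  have hvar : HasDerivAt (fun e => ∫ t in t0..tfs, G (r e t))
      (∫ t in t0..tfs, fderiv ℝ G (r 0 t) (h t, u t, 0, 0)) 0 := by
    refine aux_leibniz (fun e t => G (r e t)) (fun e t => fderiv ℝ G (r e t) (h t, u t, 0, 0))
      t0 tfs (hGc.comp hr) ((hGf.comp hr).clm_apply (by fun_prop)) ?_
    intro e t
    have h1 : HasDerivAt (fun e => r e t) (h t, u t, (0 : ℝ), (0 : ℝ)) e := by
      have l1 : ∀ c d : ℝ, HasDerivAt (fun e : ℝ => c + e * d) d e := fun c d => by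
        simpa using ((hasDerivAt_id e).mul_const d).const_add c
      exact (l1 _ _).prodMk ((l1 _ _).prodMk (hasDerivAt_const _ _))
    exact (hGd (r e t)).comp_hasDerivAt e h1
  have hr0 : ∀ t, r 0 t = q t := fun t => by simp [r, q]
  have hloc : IsLocalMin (fun e => ∫ t in t0..tfs, G (r e t)) 0 := by
    refine Filter.Eventually.of_forall fun e => ?_
    have hyd : ∀ t, HasDerivAt (fun t => xs t + e * h t) (deriv xs t + e * u t) t := fun t =>
      (hxd t).add ((hhd t).const_mul e)
    have hyd' : deriv (fun t => xs t + e * h t) = fun t => deriv xs t + e * u t :=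
      funext fun t => (hyd t).deriv
    have hy : ContDiff ℝ 1 (fun t => xs t + e * h t) := by
      rw [contDiff_one_iff_deriv]
      refine ⟨fun t => (hyd t).differentiableAt, ?_⟩
      rw [hyd']
      fun_prop
    have := hmin tfs htfs _ hy (by simp [hh0, hxs0])
    rw [hyd'] at this
    simp only [hr0]
    exact this
  have hzero := hloc.hasDerivAt_eq_zero hvar
  have hEL : ∫ t in t0..tfs, (A t * h t + B t * u t) = 0 := by
    rw [← hzero]
    refine intervalIntegral.integral_congr fun t _ => ?_
    have e1 : (h t, u t, (0 : ℝ), (0 : ℝ)) =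
      h t • ((1 : ℝ), (0 : ℝ), (0 : ℝ), (0 : ℝ)) + u t • ((0 : ℝ), (1 : ℝ), (0 : ℝ), (0 : ℝ)) := by
      simp
    simp only [hr0]
    rw [e1, map_add, map_smul, map_smul]
    simp only [A, B, smul_eq_mul]
    ring
  have hsq : ∫ t in t0..tfs, u t * u t = 0 := by
    have e2 : ∀ t, u t * u t = (A t * h t + B t * u t) - (A t * h t + Q t * u t) := fun t => by
      simp only [u]; ring
    simp_rw [e2]
    rw [intervalIntegral.integral_sub, hEL, hparts, sub_zero]
    · exact Continuous.intervalIntegrable (by fun_prop) _ _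
    · exact Continuous.intervalIntegrable (by fun_prop) _ _
  have hu0 : ∀ t ∈ Set.Icc t0 tfs, B t = Q t := by
    intro t ht
    by_contra hne
    have hpos := intervalIntegral.integral_pos htfs (f := fun t => u t * u t)
      (hu.mul hu).continuousOn (fun t _ => mul_self_nonneg _)
      ⟨t, ht, mul_self_pos.2 (sub_ne_zero.2 hne)⟩
    exact hpos.ne' hsq
  refine ⟨⟨∫ s in tfs..t0, A s, fun t ht => ?_⟩, ?_, ?_⟩
  · rw [eB, hu0 t ht]
    simp_rw [eA]
    exact (intervalIntegral.integral_add_adjacent_intervals (hA.intervalIntegrable _ _)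
      (hA.intervalIntegrable _ _)).symm
  · rw [eB, hu0 tfs ⟨htfs.le, le_rfl⟩, hQ0]
  · have hd := ((hGc.comp hq).integral_hasStrictDerivAt t0 tfs).hasDerivAt
    refine IsLocalMin.hasDerivAt_eq_zero ?_ hd
    filter_upwards [lt_mem_nhds htfs] with T hT
    exact hmin T hT xs hxs hxs0
end

section
/- (Theorem 5, necessary conditions with uncertainty in the state equation and cost, fixed final time and free final state.) Let (u*, a*) with trajectory x* be a min-max solution of the optimal control problem, and let p* : ℝ → ℝ be a continuously differentiable solution on [t0, tf] of the costate equation p'(t) = −(∂H/∂x)(x*(t), u*(t), p(t), a*, t) with the transversality terminal condition p(tf) = (∂h/∂x)(x*(tf), tf). Then for every t ∈ [t0, tf], (∂H/∂u)(x*(t), u*(t), p*(t), a*, t) = 0, and moreover ∫_{t0}^{tf} (∂H/∂a)(x*(t), u*(t), p*(t), a*, t) dt = 0. -/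
/-- The expanded Hamiltonian `H(x, u, p, a, t) = g(x, u, a, t) + p · f(x, u, a, t)`. -/
noncomputable def expandedHamiltonian (f g : ℝ → ℝ → ℝ → ℝ → ℝ)
    (x u p a t : ℝ) : ℝ :=
  g x u a t + p * f x u a t

open Set MeasureTheory Filter Topology

lemma aux_ode (t0 tf x0 : ℝ) (ht : t0 ≤ tf) (Φ : ℝ → ℝ → ℝ)
    (hc : Continuous (fun q : ℝ × ℝ => Φ q.1 q.2)) (L K : NNReal)
    (hL : ∀ t ∈ Icc t0 tf, ∀ x, ‖Φ t x‖ ≤ L)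
    (hK : ∀ t ∈ Icc t0 tf, LipschitzWith K (Φ t)) :
    ∃ x : ℝ → ℝ, ContDiff ℝ 1 x ∧ x t0 = x0 ∧ ∀ t ∈ Icc t0 tf, HasDerivAt x (Φ t (x t)) t := by
  have hP : IsPicardLindelof Φ (⟨t0, left_mem_Icc.2 ht⟩ : Icc t0 tf) x0
      (L * (tf - t0).toNNReal) 0 L K := by
    refine ⟨fun t h => (hK t h).lipschitzOnWith, fun x _ => ?_, fun t h x _ => hL t h x, ?_⟩
    · exact (hc.comp (by fun_prop : Continuous fun t : ℝ => (t, x))).continuousOn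
    · have : 0 ≤ tf - t0 := by linarith
      simp [this]
  obtain ⟨α, hα0, hα⟩ := hP.exists_eq_forall_mem_Icc_hasDerivWithinAt₀
  have hαc : ContinuousOn α (Icc t0 tf) := fun t h => (hα t h).continuousWithinAt
  let q : ℝ → ℝ := fun τ => max t0 (min tf τ)
  have hq : ∀ τ, q τ ∈ Icc t0 tf := fun τ => ⟨le_max_left _ _, max_le ht (min_le_left _ _)⟩
  have hqe : ∀ τ ∈ Icc t0 tf, q τ = τ := fun τ h => by simp [q, h.1, h.2]
  have hqc : Continuous q := by fun_prop
  have hαq : Continuous (fun τ => α (q τ)) := hαc.comp_continuous hqc hq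
  have hi : Continuous (fun τ => Φ τ (α (q τ))) :=
    hc.comp (continuous_id.prodMk hαq)
  let x : ℝ → ℝ := fun t => x0 + ∫ τ in t0..t, Φ τ (α (q τ))
  have hx : ∀ t, HasDerivAt x (Φ t (α (q t))) t := fun t =>
    (intervalIntegral.integral_hasDerivAt_right (hi.intervalIntegrable _ _)
      (hi.stronglyMeasurableAtFilter _ _) hi.continuousAt).const_add x0
  have hxα : ∀ t ∈ Icc t0 tf, x t = α t := by
    intro t h
    have : ∫ τ in t0..t, Φ τ (α (q τ)) = α t - α t0 := by
      apply intervalIntegral.integral_eq_sub_of_hasDerivAt_of_le h.1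
      · exact hαc.mono (Icc_subset_Icc_right h.2)
      · intro s hs
        have hs' : s ∈ Icc t0 tf := ⟨hs.1.le, hs.2.le.trans h.2⟩
        rw [hqe s hs']
        exact (hα s hs').hasDerivAt (Icc_mem_nhds hs.1 (hs.2.trans_le h.2))
      · exact hi.intervalIntegrable _ _
    simp only [x, this]
    simp at hα0
    rw [hα0]; ring
  refine ⟨x, ?_, by simp [x], fun t h => ?_⟩
  · rw [contDiff_one_iff_deriv]
    refine ⟨fun t => (hx t).differentiableAt, ?_⟩
    have : deriv x = fun t => Φ t (α (q t)) := funext fun t => (hx t).deriv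
    rw [this]; exact hi
  · have := hx t
    rwa [hqe t h, ← hxα t h] at this

/-- perturbed argument -/
def auxZ (us v : ℝ → ℝ) (as b : ℝ) (y e t : ℝ) : ℝ × ℝ × ℝ × ℝ :=
  (y, us t + e * v t, as + e * b, t)

lemma auxZ_cont {us v : ℝ → ℝ} (hus : Continuous us) (hv : Continuous v) (as b e : ℝ) {y : ℝ → ℝ}
    (hy : Continuous y) : Continuous (fun t => auxZ us v as b (y t) e t) := by
  unfold auxZ; fun_prop

lemma auxZ_box {us v xs : ℝ → ℝ} (hus : Continuous us) (hv : Continuous v)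
    (hxs : Continuous xs) (as b t0 tf : ℝ) :
    ∃ R, ∀ t ∈ Icc t0 tf, ∀ e, |e| ≤ 1 → ∀ y, |y - xs t| ≤ 1 →
      auxZ us v as b y e t ∈ Metric.closedBall (0 : ℝ × ℝ × ℝ × ℝ) R := by
  have hk : IsCompact ((Icc t0 tf) ×ˢ ((Icc (-1) 1 : Set ℝ) ×ˢ (Icc (-1) 1 : Set ℝ))) :=
    isCompact_Icc.prod (isCompact_Icc.prod isCompact_Icc)
  have hc : Continuous (fun q : ℝ × ℝ × ℝ => auxZ us v as b (xs q.1 + q.2.2) q.2.1 q.1) := by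
    unfold auxZ; fun_prop
  obtain ⟨R, hR⟩ := (hk.image hc).isBounded.subset_closedBall 0
  refine ⟨R, fun t h e he y hy => hR ⟨(t, e, y - xs t), ⟨h, abs_le.1 he, abs_le.1 hy⟩, ?_⟩⟩
  simp

lemma auxZ_dist {us v : ℝ → ℝ} (hv : Continuous v) (as b t0 tf : ℝ) :
    ∃ M, 0 ≤ M ∧ ∀ t ∈ Icc t0 tf, ∀ e y y₀,
      ‖auxZ us v as b y e t - auxZ us v as b y₀ 0 t‖ ≤ |y - y₀| + M * |e| := by
  obtain ⟨M, hM⟩ := isCompact_Icc.exists_bound_of_continuousOn (s := Icc t0 tf) hv.continuousOn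
  refine ⟨max |b| M, (abs_nonneg b).trans (le_max_left _ _), fun t h e y y₀ => ?_⟩
  have h1 := hM t h
  have h2 : 0 ≤ max |b| M * |e| := by positivity
  have h3 : |e| * |v t| ≤ max |b| M * |e| := by
    rw [mul_comm]; gcongr; exact h1.trans (le_max_right _ _)
  have h4 : |e| * |b| ≤ max |b| M * |e| := by
    rw [mul_comm]; gcongr; exact le_max_left _ _
  have h5 := abs_nonneg (y - y₀)
  simp only [auxZ, Prod.norm_def, Prod.fst_sub, Prod.snd_sub, Real.norm_eq_abs]
  refine max_le (by linarith) (max_le ?_ (max_le ?_ ?_))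
  · simp [abs_mul]; linarith
  · simp [abs_mul]; linarith
  · simp; linarith

lemma aux_traj (F : ℝ × ℝ × ℝ × ℝ → ℝ) (hF : ContDiff ℝ 1 F) (t0 tf : ℝ) (ht : t0 < tf)
    (us v xs : ℝ → ℝ) (hus : Continuous us) (hv : Continuous v) (hxs : ContDiff ℝ 1 xs)
    (as b : ℝ) (hxseq : ∀ t ∈ Icc t0 tf, deriv xs t = F (xs t, us t, as, t)) :
    ∃ C, 0 ≤ C ∧ ∃ η, 0 < η ∧ η ≤ 1 ∧ ∀ e, |e| < η → ∃ x : ℝ → ℝ, ContDiff ℝ 1 x ∧ x t0 = xs t0 ∧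
      (∀ t ∈ Icc t0 tf, deriv x t = F (auxZ us v as b (x t) e t)) ∧
      ∀ t ∈ Icc t0 tf, |x t - xs t| ≤ C * |e| ∧ |x t - xs t| ≤ 1 := by
  obtain ⟨R, hR⟩ := auxZ_box hus hv hxs.continuous as b t0 tf
  obtain ⟨M, hM0, hM⟩ := auxZ_dist (us := us) hv as b t0 tf
  obtain ⟨K, hK⟩ := hF.contDiffOn.exists_lipschitzOnWith one_ne_zero
    (convex_closedBall (0 : ℝ × ℝ × ℝ × ℝ) R) (isCompact_closedBall _ _)
  obtain ⟨L, hL⟩ := (isCompact_closedBall (0 : ℝ × ℝ × ℝ × ℝ) R).exists_bound_of_continuousOn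
    hF.continuous.continuousOn
  have hxc := hxs.continuous
  let c : ℝ → ℝ → ℝ := fun t x => xs t + max (-1) (min 1 (x - xs t))
  have hc1 : ∀ t x, |c t x - xs t| ≤ 1 := fun t x => by
    simp only [c, add_sub_cancel_left, abs_le]
    exact ⟨le_max_left _ _, max_le (by norm_num) (min_le_left _ _)⟩
  have hcl : ∀ t x y, |c t x - c t y| ≤ |x - y| := fun t x y => by
    simp only [c, add_sub_add_left_eq_sub]
    have h1 := abs_max_sub_max_le_max (-1) (min 1 (x - xs t)) (-1) (min 1 (y - xs t))
    have h2 := abs_min_sub_min_le_max 1 (x - xs t) 1 (y - xs t)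
    simp at h1 h2
    exact h1.trans h2
  have hce : ∀ t x, |x - xs t| ≤ 1 → c t x = x := fun t x h => by
    simp [c, (abs_le.1 h).1, (abs_le.1 h).2]
  let E := Real.exp ((K + 1) * (tf - t0))
  have hE : 0 < E := Real.exp_pos _
  refine ⟨M * E, by positivity, min 1 (1 / (M * E + 1)), by positivity, min_le_left _ _, fun e he => ?_⟩
  have he1 : |e| ≤ 1 := (he.trans_le (min_le_left _ _)).le
  have he2 : M * E * |e| ≤ 1 := by
    have h1 := (he.trans_le (min_le_right _ _)).le
    rw [le_div_iff₀ (by positivity)] at h1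
    nlinarith [abs_nonneg e]
  obtain ⟨x, hx1, hx0, hx⟩ := aux_ode t0 tf (xs t0) ht.le
    (fun t x => F (auxZ us v as b (c t x) e t))
    (hF.continuous.comp (by simp only [auxZ, c]; fun_prop)) L.toNNReal K
    (fun t h x => (hL _ (hR t h e he1 _ (hc1 t x))).trans (Real.le_coe_toNNReal L))
    (fun t h => LipschitzWith.of_dist_le_mul fun x y => by
      refine (hK.dist_le_mul _ (hR t h e he1 _ (hc1 t x)) _ (hR t h e he1 _ (hc1 t y))).trans ?_
      gcongr
      simp only [auxZ, Prod.dist_eq, dist_self]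
      simpa [Real.dist_eq] using hcl t x y)
  have hxd : ∀ t ∈ Icc t0 tf, HasDerivAt (fun t => x t - xs t)
      (F (auxZ us v as b (c t (x t)) e t) - F (auxZ us v as b (xs t) 0 t)) t := fun t h => by
    refine (hx t h).sub ?_
    have := (hxs.differentiable one_ne_zero t).hasDerivAt
    rw [hxseq t h] at this
    simpa [auxZ] using this
  have hgr := norm_le_gronwallBound_of_norm_deriv_right_le (f := fun t => x t - xs t)
    (δ := 0) (K := K + 1) (ε := (K + 1) * (M * |e|)) (a := t0) (b := tf)
    (hx1.continuous.sub hxs.continuous).continuousOn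
    (fun t h => (hxd t ⟨h.1, h.2.le⟩).hasDerivWithinAt) (by simp [hx0])
    (fun t h => by
      have h' : t ∈ Icc t0 tf := ⟨h.1, h.2.le⟩
      have h1 := hK.dist_le_mul _ (hR t h' e he1 _ (hc1 t (x t))) _
        (hR t h' 0 (by simp) (xs t) (by simp))
      rw [dist_eq_norm, dist_eq_norm] at h1
      have h2 := hM t h' e (c t (x t)) (xs t)
      have h3 := hcl t (x t) (xs t)
      rw [hce t (xs t) (by simp)] at h3
      refine h1.trans ?_
      rw [Real.norm_eq_abs]
      have h4 : (0:ℝ) ≤ K := K.2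
      have h5 : 0 ≤ |x t - xs t| + M * |e| := by positivity
      calc _ ≤ (K:ℝ) * (|x t - xs t| + M * |e|) := by gcongr; linarith
        _ ≤ _ := by nlinarith)
  have hK1 : (K : ℝ) + 1 ≠ 0 := by positivity
  have hfin : ∀ t ∈ Icc t0 tf, |x t - xs t| ≤ M * E * |e| := fun t h => by
    have h1 := hgr t h
    rw [gronwallBound_of_K_ne_0 hK1, Real.norm_eq_abs] at h1
    refine h1.trans ?_
    have h2 : Real.exp ((K + 1) * (t - t0)) ≤ E := by
      apply Real.exp_le_exp.2; gcongr; exact h.2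
    simp only []
    rw [zero_mul, zero_add, mul_div_cancel_left₀ _ hK1]
    have : 0 ≤ M * |e| := by positivity
    nlinarith
  refine ⟨x, hx1, hx0, fun t h => ?_,
    fun t h => ⟨hfin t h, (hfin t h).trans he2⟩⟩
  rw [(hx t h).deriv, hce t _ ((hfin t h).trans he2)]

lemma aux_deriv {V : Type*} [NormedAddCommGroup V] [NormedSpace ℝ V] (Ψ : V → ℝ) (z : ℝ → V)
    (L : V →L[ℝ] ℝ) (hΨ : HasFDerivAt Ψ L (z 0)) (C m : ℝ)
    (h1 : ∀ᶠ e in 𝓝 (0:ℝ), ‖z e - z 0‖ ≤ C * |e|)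
    (h2 : ∀ᶠ e in 𝓝 (0:ℝ), L (z e - z 0) = e * m) :
    HasDerivAt (fun e => Ψ (z e)) m 0 := by
  have hO : (fun e => z e - z 0) =O[𝓝 0] (fun e : ℝ => e - 0) :=
    Asymptotics.IsBigO.of_bound C (by simpa using h1)
  have ht : Tendsto z (𝓝 0) (𝓝 (z 0)) := by
    rw [tendsto_iff_norm_sub_tendsto_zero]
    have : Tendsto (fun e : ℝ => C * |e|) (𝓝 0) (𝓝 0) := by
      have : Continuous (fun e : ℝ => C * |e|) := by fun_prop
      simpa using this.tendsto 0
    exact squeeze_zero' (Eventually.of_forall fun e => norm_nonneg _) h1 this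
  rw [hasDerivAt_iff_isLittleO]
  refine ((hΨ.isLittleO.comp_tendsto ht).trans_isBigO hO).congr' ?_ .rfl
  filter_upwards [h2] with e he
  simp only [Function.comp, he, sub_zero, smul_eq_mul]

lemma aux_main (F G : ℝ × ℝ × ℝ × ℝ → ℝ) (hF : ContDiff ℝ 1 F) (hG : ContDiff ℝ 1 G) (h : ℝ → ℝ)
    (t0 tf : ℝ) (ht : t0 < tf)
    (us v xs ps : ℝ → ℝ) (hus : Continuous us) (hv : Continuous v) (hxs : ContDiff ℝ 1 xs)
    (hps : ContDiff ℝ 1 ps)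
    (as b : ℝ) (hxseq : ∀ t ∈ Icc t0 tf, deriv xs t = F (xs t, us t, as, t))
    (hh : HasDerivAt h (ps tf) (xs tf))
    (hpseq : ∀ t ∈ Icc t0 tf, deriv ps t = -(fderiv ℝ G (xs t, us t, as, t) (1, 0, 0, 0)
      + ps t * fderiv ℝ F (xs t, us t, as, t) (1, 0, 0, 0)))
    (Hu Ha : ℝ → ℝ) (hHuc : Continuous Hu) (hHac : Continuous Ha)
    (hHu : ∀ t, Hu t = fderiv ℝ G (xs t, us t, as, t) (0, 1, 0, 0)
      + ps t * fderiv ℝ F (xs t, us t, as, t) (0, 1, 0, 0))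
    (hHa : ∀ t, Ha t = fderiv ℝ G (xs t, us t, as, t) (0, 0, 1, 0)
      + ps t * fderiv ℝ F (xs t, us t, as, t) (0, 0, 1, 0)) :
    ∃ J : ℝ → ℝ, HasDerivAt J (∫ t in t0..tf, (Hu t * v t + Ha t * b)) 0 ∧
      J 0 = h (xs tf) + ∫ t in t0..tf, G (xs t, us t, as, t) ∧
      ∀ᶠ e in 𝓝 (0:ℝ), ∃ x : ℝ → ℝ, ContDiff ℝ 1 x ∧ x t0 = xs t0 ∧
        (∀ t ∈ Icc t0 tf, deriv x t = F (auxZ us v as b (x t) e t)) ∧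
        J e = h (x tf) + ∫ t in t0..tf, G (auxZ us v as b (x t) e t) := by
  obtain ⟨C, hC0, η, hη, hη1, hX⟩ := aux_traj F hF t0 tf ht us v xs hus hv hxs as b hxseq
  have hX' : ∀ e, ∃ x : ℝ → ℝ, |e| < η → ContDiff ℝ 1 x ∧ x t0 = xs t0 ∧
      (∀ t ∈ Icc t0 tf, deriv x t = F (auxZ us v as b (x t) e t)) ∧
      ∀ t ∈ Icc t0 tf, |x t - xs t| ≤ C * |e| ∧ |x t - xs t| ≤ 1 := fun e => by
    by_cases he : |e| < η
    · obtain ⟨x, hx⟩ := hX e he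
      exact ⟨x, fun _ => hx⟩
    · exact ⟨xs, fun h => absurd h he⟩
  choose X hX using hX'
  obtain ⟨R, hR⟩ := auxZ_box hus hv hxs.continuous as b t0 tf
  obtain ⟨M, hM0, hM⟩ := auxZ_dist (us := us) hv as b t0 tf
  obtain ⟨KF, hKF⟩ := hF.contDiffOn.exists_lipschitzOnWith one_ne_zero
    (convex_closedBall (0 : ℝ × ℝ × ℝ × ℝ) R) (isCompact_closedBall _ _)
  obtain ⟨KG, hKG⟩ := hG.contDiffOn.exists_lipschitzOnWith one_ne_zero
    (convex_closedBall (0 : ℝ × ℝ × ℝ × ℝ) R) (isCompact_closedBall _ _)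
  have hdps : Continuous (deriv ps) := hps.continuous_deriv le_rfl
  obtain ⟨P, hP⟩ := isCompact_Icc.exists_bound_of_continuousOn (s := Icc t0 tf)
    hps.continuous.continuousOn
  obtain ⟨P', hP'⟩ := isCompact_Icc.exists_bound_of_continuousOn (s := Icc t0 tf)
    hdps.continuousOn
  have hxc := hxs.continuous
  have hpc := hps.continuous
  have hFc := hF.continuous
  have hGc := hG.continuous
  have hev : ∀ᶠ e in 𝓝 (0:ℝ), |e| < η := by
    have : Metric.ball (0:ℝ) η ∈ 𝓝 (0:ℝ) := Metric.ball_mem_nhds _ hη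
    filter_upwards [this] with e he
    simpa using he
  have h0 : ∀ t ∈ Icc t0 tf, X 0 t = xs t := fun t h => by
    have := ((hX 0 (by simpa using hη)).2.2.2 t h).1
    simp at this
    linarith
  have htf : tf ∈ Icc t0 tf := right_mem_Icc.2 ht.le
  have hz0 : ∀ t, auxZ us v as b (xs t) 0 t = (xs t, us t, as, t) := fun t => by simp [auxZ]
  have hzc : ∀ e, |e| < η → Continuous (fun t => auxZ us v as b (X e t) e t) := fun e he =>
    auxZ_cont hus hv as b e (hX e he).1.continuous
  have hz0c : Continuous (fun t => auxZ us v as b (xs t) 0 t) := auxZ_cont hus hv as b 0 hxc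
  have hdist : ∀ e, |e| < η → ∀ t ∈ Icc t0 tf,
      ‖auxZ us v as b (X e t) e t - auxZ us v as b (xs t) 0 t‖ ≤ (C + M) * |e| :=
    fun e he t h => by
      have h1 := hM t h e (X e t) (xs t)
      have h2 := ((hX e he).2.2.2 t h).1
      linarith
  let I : ℝ → ℝ → ℝ := fun e t => G (auxZ us v as b (X e t) e t)
    + ps t * (F (auxZ us v as b (X e t) e t) - F (auxZ us v as b (xs t) 0 t))
    + deriv ps t * (X e t - xs t)
  have hIc : ∀ e, |e| < η → Continuous (I e) := fun e he => by
    have h1 := hzc e he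
    have h2 := (hX e he).1.continuous
    have h3 := hGc.comp h1
    have h4 := hFc.comp h1
    have h5 := hFc.comp hz0c
    exact (h3.add (hpc.mul (h4.sub h5))).add (hdps.mul (h2.sub hxc))
  have hI : HasDerivAt (fun e => ∫ t in t0..tf, I e t) (∫ t in t0..tf, (Hu t * v t + Ha t * b)) 0 := by
    have hF'c : Continuous (fun t => (Hu t * v t + Ha t * b) • (1 : ℝ →L[ℝ] ℝ)) := by fun_prop
    have hae : ∀ᵐ t ∂(volume.restrict (Ioc t0 tf)), t ∈ Icc t0 tf := by
      filter_upwards [ae_restrict_mem measurableSet_Ioc] with t h using Ioc_subset_Icc_self h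
    have key := (hasFDerivAt_integral_of_dominated_loc_of_lip' (𝕜 := ℝ)
      (μ := volume.restrict (Ioc t0 tf)) (F := I) (x₀ := 0)
      (F' := fun t => (Hu t * v t + Ha t * b) • (1 : ℝ →L[ℝ] ℝ))
      (s := Metric.ball 0 η)
      (bound := fun _ => (KG * (C + M) + P * (KF * (C + M)) + P' * C))
      (Metric.ball_mem_nhds _ hη)
      (fun e he => (hIc e (by simpa using he)).aestronglyMeasurable)
      ((hIc 0 (by simpa using hη)).integrableOn_Ioc)
      hF'c.aestronglyMeasurable ?_ (by simp) ?_)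
    · have := key.2.hasDerivAt
      simp only [intervalIntegral.integral_of_le ht.le]
      rw [ContinuousLinearMap.integral_apply key.1] at this
      simpa using this
    · filter_upwards [hae] with t h e he
      have he : |e| < η := by simpa using he
      have hx := (hX e he).2.2.2 t h
      have e1 : |e| ≤ 1 := he.le.trans hη1
      have hb1 := hR t h e e1 _ hx.2
      have hb2 := hR t h 0 (by simp) (xs t) (by simp)
      have d1 := hKG.dist_le_mul _ hb1 _ hb2
      have d2 := hKF.dist_le_mul _ hb1 _ hb2
      have d3 := hdist e he t h
      have d4 : I e t - I 0 t = (G (auxZ us v as b (X e t) e t) - G (auxZ us v as b (xs t) 0 t))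
        + ps t * (F (auxZ us v as b (X e t) e t) - F (auxZ us v as b (xs t) 0 t))
        + deriv ps t * (X e t - xs t) := by
        simp only [I, h0 t h]; ring
      rw [dist_eq_norm, dist_eq_norm] at d1 d2
      rw [d4, sub_zero]
      have p1 := hP t h
      have p2 := hP' t h
      have p3 : 0 ≤ P := (norm_nonneg _).trans p1
      have p4 : 0 ≤ P' := (norm_nonneg _).trans p2
      refine (norm_add₃_le).trans ?_
      rw [norm_mul, norm_mul, add_mul, add_mul]
      refine add_le_add (add_le_add ?_ ?_) ?_
      · refine d1.trans ?_
        rw [mul_assoc]; gcongr; exact d3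
      · rw [mul_assoc, mul_assoc]
        gcongr
        refine d2.trans ?_
        gcongr; exact d3
      · rw [mul_assoc]
        gcongr
        exact hx.1
    · filter_upwards [hae] with t h
      have hZ0 : auxZ us v as b (X 0 t) 0 t = (xs t, us t, as, t) := by rw [h0 t h, hz0]
      have dG := (hG.differentiable one_ne_zero (xs t, us t, as, t)).hasFDerivAt
      have dF := (hF.differentiable one_ne_zero (xs t, us t, as, t)).hasFDerivAt
      have hd := aux_deriv
        (fun z => G z + ps t * (F z - F (auxZ us v as b (xs t) 0 t)) + deriv ps t * (z.1 - xs t))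
        (fun e => auxZ us v as b (X e t) e t)
        (fderiv ℝ G (xs t, us t, as, t) + ps t • fderiv ℝ F (xs t, us t, as, t)
          + deriv ps t • ContinuousLinearMap.fst ℝ ℝ (ℝ × ℝ × ℝ))
        (by
          simp only [hZ0]
          exact (dG.add ((dF.sub_const _).const_mul _)).add
            ((hasFDerivAt_fst.sub_const _).const_mul _))
        (C + M) (Hu t * v t + Ha t * b)
        (by
          filter_upwards [hev] with e he
          rw [h0 t h]
          exact hdist e he t h)
        (by
          refine Eventually.of_forall fun e => ?_
          have : auxZ us v as b (X e t) e t - auxZ us v as b (X 0 t) 0 t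
            = (X e t - xs t) • ((1, 0, 0, 0) : ℝ × ℝ × ℝ × ℝ) + (e * v t) • (0, 1, 0, 0)
              + (e * b) • (0, 0, 1, 0) := by
            rw [h0 t h]; simp [auxZ]
          rw [this]
          simp only [map_add, map_smul, add_apply, smul_apply,
            smul_eq_mul, ContinuousLinearMap.coe_fst', hHu, hHa, hpseq t h]
          ring)
      have := hd.hasFDerivAt
      exact this.congr_fderiv (by ext; simp)
  have hD : HasDerivAt (fun e => h (X e tf) - ps tf * (X e tf - xs tf)) 0 0 := by
    refine aux_deriv (fun y => h y - ps tf * (y - xs tf)) (fun e => X e tf) 0 ?_ C 0 ?_ (by simp)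
    · simp only [h0 tf htf]
      have := (hh.sub (((hasDerivAt_id (xs tf)).sub_const (xs tf)).const_mul (ps tf))).hasFDerivAt
      exact this.congr_fderiv (by ext; simp)
    · filter_upwards [hev] with e he
      rw [h0 tf htf]
      exact ((hX e he).2.2.2 tf htf).1
  have hJI : ∀ e, |e| < η → h (X e tf) + ∫ t in t0..tf, G (auxZ us v as b (X e t) e t)
      = (h (X e tf) - ps tf * (X e tf - xs tf)) + ∫ t in t0..tf, I e t := fun e he => by
    have hx := hX e he
    have ibp := intervalIntegral.integral_deriv_mul_eq_sub (a := t0) (b := tf)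
      (u := ps) (u' := deriv ps) (v := fun t => X e t - xs t)
      (v' := fun t => F (auxZ us v as b (X e t) e t) - F (auxZ us v as b (xs t) 0 t))
      (fun t _ => (hps.differentiable one_ne_zero t).hasDerivAt)
      (fun t h => by
        rw [uIcc_of_le ht.le] at h
        have h1 := (hx.1.differentiable one_ne_zero t).hasDerivAt
        have h2 := (hxs.differentiable one_ne_zero t).hasDerivAt
        rw [hx.2.2.1 t h] at h1
        rw [hxseq t h, ← hz0] at h2
        exact h1.sub h2)
      (hdps.intervalIntegrable _ _)
      (((hFc.comp (hzc e he)).sub (hFc.comp hz0c)).intervalIntegrable _ _)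
    have hs : ∫ t in t0..tf, I e t = (∫ t in t0..tf, G (auxZ us v as b (X e t) e t))
        + ∫ t in t0..tf, (deriv ps t * (X e t - xs t) + ps t *
          (F (auxZ us v as b (X e t) e t) - F (auxZ us v as b (xs t) 0 t))) := by
      rw [← intervalIntegral.integral_add]
      · congr 1; ext t; simp only [I]; ring
      · exact (hGc.comp (hzc e he)).intervalIntegrable _ _
      · exact ((hdps.mul (hx.1.continuous.sub hxc)).add
          (hpc.mul ((hFc.comp (hzc e he)).sub (hFc.comp hz0c)))).intervalIntegrable _ _
    rw [hs, ibp, hx.2.1]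
    ring
  refine ⟨fun e => h (X e tf) + ∫ t in t0..tf, G (auxZ us v as b (X e t) e t), ?_, ?_, ?_⟩
  · have := hD.add hI
    rw [zero_add] at this
    refine this.congr_of_eventuallyEq ?_
    filter_upwards [hev] with e he using hJI e he
  · simp only [h0 tf htf]
    congr 1
    apply intervalIntegral.integral_congr
    intro t h
    rw [uIcc_of_le ht.le] at h
    simp only [h0 t h, hz0]
  · filter_upwards [hev] with e he
    exact ⟨X e, (hX e he).1, (hX e he).2.1, (hX e he).2.2.1, rfl⟩

/-- Theorem 5, necessary conditions with uncertainty in the state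
equation and cost, fixed final time and free final state: Let `(u*, a*)` with
trajectory `x*` be a min-max solution of the optimal control problem and let `p*` be a
C¹ solution of the costate equation with terminal condition
`p(tf) = h_x(x*(tf), tf)`. Then `H_u(x*(t), u*(t), p*(t), a*, t) = 0` on `[t0, tf]`
and `∫_{t0}^{tf} H_a(x*(t), u*(t), p*(t), a*, t) dt = 0`. -/
theorem optimal_control_necessary_conditions
    (t0 tf x0 : ℝ) (ht : t0 < tf)
    (f g : ℝ → ℝ → ℝ → ℝ → ℝ) (h : ℝ → ℝ → ℝ)
    (hf : ContDiff ℝ 1 (fun p : ℝ × ℝ × ℝ × ℝ => f p.1 p.2.1 p.2.2.1 p.2.2.2))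
    (hgs : ContDiff ℝ 1 (fun p : ℝ × ℝ × ℝ × ℝ => g p.1 p.2.1 p.2.2.1 p.2.2.2))
    (hh : ContDiff ℝ 1 (fun p : ℝ × ℝ => h p.1 p.2))
    (us : ℝ → ℝ) (hus : Continuous us) (as : ℝ)
    (xs : ℝ → ℝ) (hxs : ContDiff ℝ 1 xs) (hxs0 : xs t0 = x0)
    (hxseq : ∀ t ∈ Set.Icc t0 tf, deriv xs t = f (xs t) (us t) as (t))
    -- min-max optimality: the worst parameter for the control `u*`
    (hmax : ∀ a : ℝ, ∀ xa : ℝ → ℝ, ContDiff ℝ 1 xa → xa t0 = x0 →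
      (∀ t ∈ Set.Icc t0 tf, deriv xa t = f (xa t) (us t) a t) →
      h (xa tf) tf + (∫ t in t0..tf, g (xa t) (us t) a t) ≤
        h (xs tf) tf + ∫ t in t0..tf, g (xs t) (us t) as t)
    -- and the best control against the worst parameter `a*`
    (hmin : ∀ u : ℝ → ℝ, Continuous u → ∀ x : ℝ → ℝ, ContDiff ℝ 1 x → x t0 = x0 →
      (∀ t ∈ Set.Icc t0 tf, deriv x t = f (x t) (u t) as t) →
      h (xs tf) tf + (∫ t in t0..tf, g (xs t) (us t) as t) ≤
        h (x tf) tf + ∫ t in t0..tf, g (x t) (u t) as t)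
    -- the costate solution
    (ps : ℝ → ℝ) (hps : ContDiff ℝ 1 ps)
    (hpseq : ∀ t ∈ Set.Icc t0 tf,
      deriv ps t =
        -(deriv (fun y => expandedHamiltonian f g y (us t) (ps t) as t) (xs t)))
    (hpsf : ps tf = deriv (fun y => h y tf) (xs tf)) :
    (∀ t ∈ Set.Icc t0 tf,
      deriv (fun w => expandedHamiltonian f g (xs t) w (ps t) as t) (us t) = 0) ∧
    (∫ t in t0..tf,
      deriv (fun b => expandedHamiltonian f g (xs t) (us t) (ps t) b t) as) = 0 := by
  set F : ℝ × ℝ × ℝ × ℝ → ℝ := fun p => f p.1 p.2.1 p.2.2.1 p.2.2.2 with hFdef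
  set G : ℝ × ℝ × ℝ × ℝ → ℝ := fun p => g p.1 p.2.1 p.2.2.1 p.2.2.2 with hGdef
  have key : ∀ (t : ℝ) (ι : ℝ → ℝ × ℝ × ℝ × ℝ) (y : ℝ) (w : ℝ × ℝ × ℝ × ℝ),
      HasDerivAt ι w y → ι y = (xs t, us t, as, t) →
      deriv (fun y => G (ι y) + ps t * F (ι y)) y = fderiv ℝ G (xs t, us t, as, t) w
        + ps t * fderiv ℝ F (xs t, us t, as, t) w := by
    intro t ι y w hι hy
    have dG := (hgs.differentiable one_ne_zero (ι y)).hasFDerivAt.comp_hasDerivAt y hι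
    have dF := (hf.differentiable one_ne_zero (ι y)).hasFDerivAt.comp_hasDerivAt y hι
    rw [hy] at dG dF
    exact (dG.add (dF.const_mul (ps t))).deriv
  have hcon : ∀ w : ℝ × ℝ × ℝ × ℝ, Continuous (fun t => fderiv ℝ G (xs t, us t, as, t) w
        + ps t * fderiv ℝ F (xs t, us t, as, t) w) := by
    intro w
    have hz : Continuous (fun t => ((xs t, us t, as, t) : ℝ × ℝ × ℝ × ℝ)) := by
      have := hxs.continuous
      fun_prop
    have h1 := ((hgs.continuous_fderiv one_ne_zero).comp hz).clm_apply (continuous_const (y := w))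
    have h2 := ((hf.continuous_fderiv one_ne_zero).comp hz).clm_apply (continuous_const (y := w))
    exact h1.add (hps.continuous.mul h2)
  have hHx : ∀ t, deriv (fun y => expandedHamiltonian f g y (us t) (ps t) as t) (xs t) =
      fderiv ℝ G (xs t, us t, as, t) (1, 0, 0, 0)
        + ps t * fderiv ℝ F (xs t, us t, as, t) (1, 0, 0, 0) := fun t =>
    key t (fun y => (y, us t, as, t)) (xs t) _
      ((hasDerivAt_id _).prodMk (hasDerivAt_const _ _)) rfl
  have hHu : ∀ t, deriv (fun w => expandedHamiltonian f g (xs t) w (ps t) as t) (us t) =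
      fderiv ℝ G (xs t, us t, as, t) (0, 1, 0, 0)
        + ps t * fderiv ℝ F (xs t, us t, as, t) (0, 1, 0, 0) := fun t =>
    key t (fun y => (xs t, y, as, t)) (us t) _
      ((hasDerivAt_const _ _).prodMk ((hasDerivAt_id _).prodMk (hasDerivAt_const _ _))) rfl
  have hHa : ∀ t, deriv (fun w => expandedHamiltonian f g (xs t) (us t) (ps t) w t) as =
      fderiv ℝ G (xs t, us t, as, t) (0, 0, 1, 0)
        + ps t * fderiv ℝ F (xs t, us t, as, t) (0, 0, 1, 0) := fun t =>
    key t (fun y => (xs t, us t, y, t)) as _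
      ((hasDerivAt_const _ _).prodMk ((hasDerivAt_const _ _).prodMk
        ((hasDerivAt_id _).prodMk (hasDerivAt_const _ _)))) rfl
  set Hu : ℝ → ℝ := fun t => fderiv ℝ G (xs t, us t, as, t) (0, 1, 0, 0)
        + ps t * fderiv ℝ F (xs t, us t, as, t) (0, 1, 0, 0) with hHud
  set Ha : ℝ → ℝ := fun t => fderiv ℝ G (xs t, us t, as, t) (0, 0, 1, 0)
        + ps t * fderiv ℝ F (xs t, us t, as, t) (0, 0, 1, 0) with hHad
  have hhd : HasDerivAt (fun y => h y tf) (ps tf) (xs tf) := by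
    rw [hpsf]
    apply DifferentiableAt.hasDerivAt
    have h1 : Differentiable ℝ (fun y : ℝ => ((y, tf) : ℝ × ℝ)) :=
      differentiable_id.prodMk (differentiable_const tf)
    exact ((hh.differentiable one_ne_zero).comp h1) (xs tf)
  have main := fun (v : ℝ → ℝ) (hv : Continuous v) (b : ℝ) =>
    aux_main F G hf hgs (fun y => h y tf) t0 tf ht us v xs ps hus hv hxs hps as b hxseq hhd
      (fun t h => by rw [hpseq t h, hHx]) Hu Ha (hcon _) (hcon _) (fun _ => rfl) (fun _ => rfl)
  constructor
  · obtain ⟨J, hJ, hJ0, hJe⟩ := main Hu (hcon _) 0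
    have hmin' : IsLocalMin J 0 := by
      filter_upwards [hJe] with e ⟨x, hx1, hx0, hx, hxJ⟩
      rw [hJ0, hxJ]
      have := hmin (fun t => us t + e * Hu t) (hus.add (continuous_const.mul (hcon _))) x hx1
        (hx0.trans hxs0) (fun t h => by rw [hx t h]; simp [hFdef, auxZ])
      simpa [hGdef, auxZ] using this
    have hz := hmin'.hasDerivAt_eq_zero hJ
    intro t h
    rw [hHu]
    by_contra hne
    have : 0 < ∫ t in t0..tf, (Hu t * Hu t + Ha t * 0) := by
      apply intervalIntegral.integral_pos ht
      · exact (((hcon _).mul (hcon _)).add ((hcon _).mul continuous_const)).continuousOn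
      · intro s _
        nlinarith [mul_self_nonneg (Hu s)]
      · refine ⟨t, h, ?_⟩
        have : Hu t ≠ 0 := hne
        have := mul_self_pos.2 this
        linarith
    exact this.ne' hz
  · obtain ⟨J, hJ, hJ0, hJe⟩ := main (fun _ => 0) continuous_const 1
    have hmax' : IsLocalMax J 0 := by
      filter_upwards [hJe] with e ⟨x, hx1, hx0, hx, hxJ⟩
      rw [hJ0, hxJ]
      have := hmax (as + e) x hx1
        (hx0.trans hxs0) (fun t h => by rw [hx t h]; simp [hFdef, auxZ])
      simpa [hGdef, auxZ] using this
    have hz := hmax'.hasDerivAt_eq_zero hJ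
    simp only [hHa]
    simpa using hz
end

section
/- (Example 1.) For the functional J(x, a) = ∫_0^1 ( x(t)² + x'(t)² − a² − 2·a·x(t) ) dt over continuously differentiable curves x : ℝ → ℝ with x(0) = 1 and x(1) = 1 and parameters a ∈ ℝ, define x*(t) = (1/(e+1))·(1 − a*)·e^t + (e/(e+1))·(1 − a*)·e^{−t} + a* with a* = (1 − e)/2, i.e. x*(t) = (1/2)e^t + (e/2)e^{−t} + (1 − e)/2. Then (x*, a*) is a min-max solution: J(x*, a) ≤ J(x*, a*) ≤ J(x, a*) for every a ∈ ℝ and every continuously differentiable x with x(0) = x(1) = 1, and moreover J(x*, a*) = e − 1. -/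
open Real

/-- Example 1: For
`J(x, a) = ∫_0^1 (x(t)² + x'(t)² − a² − 2·a·x(t)) dt` with boundary conditions
`x(0) = 1`, `x(1) = 1`, the pair `x*(t) = (1/2)eᵗ + (e/2)e⁻ᵗ + (1 − e)/2`,
`a* = (1 − e)/2` is a min-max solution, and `J(x*, a*) = e − 1`. -/
theorem example1_minmax :
    let e : ℝ := Real.exp 1
    let J : (ℝ → ℝ) → ℝ → ℝ := fun x a =>
      ∫ t in (0:ℝ)..1, ((x t) ^ 2 + (deriv x t) ^ 2 - a ^ 2 - 2 * a * x t)
    let xs : ℝ → ℝ := fun t =>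
      (1 / 2) * Real.exp t + (e / 2) * Real.exp (-t) + (1 - e) / 2
    let as : ℝ := (1 - e) / 2
    (∀ a : ℝ, J xs a ≤ J xs as) ∧
    (∀ x : ℝ → ℝ, ContDiff ℝ 1 x → x 0 = 1 → x 1 = 1 → J xs as ≤ J x as) ∧
    J xs as = e - 1 := by
  intro e J xs as
  have hu : ∀ t, HasDerivAt (fun t => (1/2) * Real.exp t - (e/2) * Real.exp (-t))
      ((1/2) * Real.exp t + (e/2) * Real.exp (-t)) t := by
    intro t
    have h := ((Real.hasDerivAt_exp t).const_mul (1/2)).sub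
      (((hasDerivAt_neg t).exp).const_mul (e/2))
    refine h.congr_deriv ?_
    ring
  have hxs : ∀ t, HasDerivAt xs ((1/2) * Real.exp t - (e/2) * Real.exp (-t)) t := by
    intro t
    have h := (((Real.hasDerivAt_exp t).const_mul (1/2)).add
      (((hasDerivAt_neg t).exp).const_mul (e/2))).add_const ((1-e)/2)
    refine h.congr_deriv ?_
    ring
  have hd : ∀ t, deriv xs t = (1/2) * Real.exp t - (e/2) * Real.exp (-t) :=
    fun t => (hxs t).deriv
  have hE : e * Real.exp (-1) = 1 := by
    rw [← Real.exp_add]; simp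
  have he : Real.exp 1 = e := rfl
  have hcx : Continuous xs := by fun_prop
  have hcd : Continuous (deriv xs) := by
    rw [funext hd]; fun_prop
  have hF : ∀ a t, HasDerivAt (fun t => (xs t - as) * ((1/2) * Real.exp t - (e/2) * Real.exp (-t))
      + 2 * (as - a) * ((1/2) * Real.exp t - (e/2) * Real.exp (-t))
      + (as^2 - a^2 - 2*a*as) * t)
      ((xs t) ^ 2 + (deriv xs t) ^ 2 - a ^ 2 - 2 * a * xs t) t := by
    intro a t
    have h := ((((hxs t).sub_const as).mul (hu t)).add ((hu t).const_mul (2 * (as - a)))).add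
      ((hasDerivAt_id t).const_mul (as^2 - a^2 - 2*a*as))
    refine h.congr_deriv ?_
    rw [hd]
    have : (1/2) * Real.exp t + (e/2) * Real.exp (-t) = xs t - as := by
      simp only [xs, as]; ring
    rw [this]; ring
  have hJ : ∀ a, J xs a = (e^2-1)/2 + 2*(as-a)*(e-1) + (as^2-a^2-2*a*as) := by
    intro a
    have h := intervalIntegral.integral_eq_sub_of_hasDerivAt (a := 0) (b := 1)
      (fun t _ => hF a t) (Continuous.intervalIntegrable (by fun_prop) _ _)
    simp only [J]
    rw [h]
    simp only [xs, as, neg_zero, Real.exp_zero, he]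
    linear_combination (-(1/4) * (e * Real.exp (-1) + 1) - (as - a)) * hE
  refine ⟨?_, ?_, ?_⟩
  · intro a
    rw [hJ, hJ]
    simp only [as]
    nlinarith [sq_nonneg (a - (1-e)/2)]
  · intro x hx h0 h1
    have hx' : ∀ t, HasDerivAt x (deriv x t) t := fun t =>
      (hx.differentiable (by norm_num) t).hasDerivAt
    have hcx2 : Continuous x := hx.continuous
    have hcd2 : Continuous (deriv x) := hx.continuous_deriv (by norm_num)
    have hG : ∀ t, HasDerivAt
        (fun t => ((1/2) * Real.exp t - (e/2) * Real.exp (-t)) * (x t - xs t))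
        ((xs t - as) * (x t - xs t) + deriv xs t * (deriv x t - deriv xs t)) t := by
      intro t
      have h := (hu t).mul ((hx' t).sub (hxs t))
      refine h.congr_deriv ?_
      rw [hd]
      simp only [xs, as, Pi.sub_apply]; ring
    have h := intervalIntegral.integral_eq_sub_of_hasDerivAt (a := 0) (b := 1)
      (fun t _ => hG t) (Continuous.intervalIntegrable (by fun_prop) _ _)
    have x0 : xs 0 = 1 := by simp only [xs, neg_zero, Real.exp_zero]; ring
    have x1 : xs 1 = 1 := by
      simp only [xs, he]; linear_combination (1/2) * hE
    rw [h0, h1, x0, x1] at h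
    have hI : J xs as = ∫ t in (0:ℝ)..1, (((xs t) ^ 2 + (deriv xs t) ^ 2 - as ^ 2 - 2 * as * xs t)
        + 2 * ((xs t - as) * (x t - xs t) + deriv xs t * (deriv x t - deriv xs t))) := by
      rw [intervalIntegral.integral_add (Continuous.intervalIntegrable (by fun_prop) _ _)
        (Continuous.intervalIntegrable (by fun_prop) _ _),
        intervalIntegral.integral_const_mul, h]
      simp [J]
    rw [hI]
    apply intervalIntegral.integral_mono_on (by norm_num)
      (Continuous.intervalIntegrable (by fun_prop) _ _)
      (Continuous.intervalIntegrable (by fun_prop) _ _)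
    intro t _
    nlinarith [sq_nonneg (x t - xs t), sq_nonneg (deriv x t - deriv xs t)]
  · rw [hJ]
    simp only [as]
    ring
end

section
/- (Min-min variant from the Remark to Theorems 1–4, sufficiency form.) Let x* be admissible and a* ∈ ℝ. Assume: (i) for each t ∈ [t0, tf] the map (x, v, a) ↦ g(x, v, a, t) is convex on ℝ³; (ii) the function t ↦ (∂g/∂v)(x*(t), x*'(t), a*, t) is differentiable on [t0, tf] with derivative (∂g/∂x)(x*(t), x*'(t), a*, t); (iii) ∫_{t0}^{tf} (∂g/∂a)(x*(t), x*'(t), a*, t) dt = 0. Then (x*, a*) is a min-min solution: J(x*, a*) ≤ J(x, a) for every a ∈ ℝ and every admissible x. -/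
/-- Min-min variant from the Remark to Theorems 1–4, sufficiency form:
If (i) `(x, v, a) ↦ g(x, v, a, t)` is jointly convex for each `t ∈ [t0, tf]`,
(ii) `x*` satisfies the Euler–Lagrange equation at `a*`, and
(iii) `∫_{t0}^{tf} g_a(x*(t), x*'(t), a*, t) dt = 0`, then `(x*, a*)` is a min-min
solution: `J(x*, a*) ≤ J(x, a)` for every `a ∈ ℝ` and every admissible `x`. -/
theorem minmin_sufficient_fixed_endpoints
    (t0 tf x0 xf : ℝ) (ht : t0 < tf)
    (g : ℝ → ℝ → ℝ → ℝ → ℝ)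
    (hg : ContDiff ℝ 1 (fun p : ℝ × ℝ × ℝ × ℝ => g p.1 p.2.1 p.2.2.1 p.2.2.2))
    (xs : ℝ → ℝ) (as : ℝ)
    (hxs : ContDiff ℝ 1 xs) (hxs0 : xs t0 = x0) (hxsf : xs tf = xf)
    (hconv : ∀ t ∈ Set.Icc t0 tf,
      ConvexOn ℝ Set.univ (fun p : ℝ × ℝ × ℝ => g p.1 p.2.1 p.2.2 t))
    (hEL : ∀ t ∈ Set.Icc t0 tf,
      HasDerivAt (fun τ => deriv (fun v => g (xs τ) v as τ) (deriv xs τ))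
        (deriv (fun y => g y (deriv xs t) as t) (xs t)) t)
    (hstat : (∫ t in t0..tf, deriv (fun b => g (xs t) (deriv xs t) b t) as) = 0) :
    ∀ a : ℝ, ∀ x : ℝ → ℝ, ContDiff ℝ 1 x → x t0 = x0 → x tf = xf →
      (∫ t in t0..tf, g (xs t) (deriv xs t) as t) ≤
        ∫ t in t0..tf, g (x t) (deriv x t) a t := by
  intro a x hx hx0 hxf
  set G : ℝ × ℝ × ℝ × ℝ → ℝ := fun p => g p.1 p.2.1 p.2.2.1 p.2.2.2 with hG
  have hGd : ∀ p, HasFDerivAt G (fderiv ℝ G p) p := fun p =>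
    (hg.differentiable one_ne_zero p).hasFDerivAt
  have hGc : Continuous (fderiv ℝ G) := hg.continuous_fderiv one_ne_zero
  have hGcont : Continuous G := hg.continuous
  have cxs := hxs.continuous
  have cx := hx.continuous
  have cdxs : Continuous (deriv xs) := hxs.continuous_deriv le_rfl
  have cdx : Continuous (deriv x) := hx.continuous_deriv le_rfl
  set P : ℝ → ℝ × ℝ × ℝ × ℝ := fun t => (xs t, deriv xs t, as, t) with hP
  have cP : Continuous P := by fun_prop
  have line : ∀ (p w : ℝ × ℝ × ℝ × ℝ) (s : ℝ),
      HasDerivAt (fun s : ℝ => p + s • w) w s := by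
    intro p w s
    simpa using ((hasDerivAt_id s).smul_const w).const_add p
  have e1 : ∀ t, deriv (fun y => g y (deriv xs t) as t) (xs t)
      = fderiv ℝ G (P t) (1, 0, 0, 0) := by
    intro t
    have h1 : HasDerivAt (fun y : ℝ => ((y, deriv xs t, as, t) : ℝ × ℝ × ℝ × ℝ))
        (1, 0, 0, 0) (xs t) :=
      (hasDerivAt_id _).prodMk (hasDerivAt_const _ _)
    exact ((hGd (P t)).comp_hasDerivAt (xs t) h1).deriv
  have e2 : ∀ t, deriv (fun v => g (xs t) v as t) (deriv xs t)
      = fderiv ℝ G (P t) (0, 1, 0, 0) := by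
    intro t
    have h1 : HasDerivAt (fun y : ℝ => ((xs t, y, as, t) : ℝ × ℝ × ℝ × ℝ))
        (0, 1, 0, 0) (deriv xs t) :=
      (hasDerivAt_const _ _).prodMk ((hasDerivAt_id _).prodMk (hasDerivAt_const _ _))
    exact ((hGd (P t)).comp_hasDerivAt (deriv xs t) h1).deriv
  have e3 : ∀ t, deriv (fun b => g (xs t) (deriv xs t) b t) as
      = fderiv ℝ G (P t) (0, 0, 1, 0) := by
    intro t
    have h1 : HasDerivAt (fun y : ℝ => ((xs t, deriv xs t, y, t) : ℝ × ℝ × ℝ × ℝ))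
        (0, 0, 1, 0) as :=
      (hasDerivAt_const _ _).prodMk ((hasDerivAt_const _ _).prodMk
        ((hasDerivAt_id _).prodMk (hasDerivAt_const _ _)))
    exact ((hGd (P t)).comp_hasDerivAt as h1).deriv
  simp only [e1, e2] at hEL
  simp only [e3] at hstat
  have cF : ∀ w, Continuous (fun t => fderiv ℝ G (P t) w) := fun w =>
    (hGc.comp cP).clm_apply continuous_const
  set A : ℝ → ℝ := fun t => fderiv ℝ G (P t) (1, 0, 0, 0) with hA
  set B : ℝ → ℝ := fun t => fderiv ℝ G (P t) (0, 1, 0, 0) with hB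
  set C : ℝ → ℝ := fun t => fderiv ℝ G (P t) (0, 0, 1, 0) with hC
  have cA : Continuous A := cF _
  have cB : Continuous B := cF _
  have cC : Continuous C := cF _
  have key : ∀ t ∈ Set.Icc t0 tf,
      g (xs t) (deriv xs t) as t + ((A t * (x t - xs t) + B t * (deriv x t - deriv xs t))
        + C t * (a - as)) ≤ g (x t) (deriv x t) a t := by
    intro t htt
    set w : ℝ × ℝ × ℝ × ℝ := (x t - xs t, deriv x t - deriv xs t, a - as, 0) with hw
    have hd : HasDerivAt (fun s : ℝ => G (P t + s • w)) (fderiv ℝ G (P t) w) 0 := by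
      have h0 : HasFDerivAt G (fderiv ℝ G (P t)) (P t + (0:ℝ) • w) := by
        simpa using hGd (P t)
      exact h0.comp_hasDerivAt (0:ℝ) (line (P t) w 0)
    have hc : ConvexOn ℝ Set.univ (fun s : ℝ => G (P t + s • w)) := by
      refine ⟨convex_univ, ?_⟩
      intro s _ r _ α β hα hβ hαβ
      have := (hconv t htt).2 (x := (xs t + s * (x t - xs t),
        deriv xs t + s * (deriv x t - deriv xs t), as + s * (a - as))) (Set.mem_univ _)
        (y := (xs t + r * (x t - xs t),
        deriv xs t + r * (deriv x t - deriv xs t), as + r * (a - as))) (Set.mem_univ _)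
        hα hβ hαβ
      have hβ' : β = 1 - α := by linarith
      subst hβ'
      simp only [hG, hP, hw, Prod.fst_add, Prod.snd_add, Prod.smul_fst, Prod.smul_snd,
        smul_eq_mul, mul_zero, add_zero] at this ⊢
      convert this using 2 <;> ring
    have hs := hc.le_slope_of_hasDerivAt (Set.mem_univ 0) (Set.mem_univ 1) one_pos hd
    have hwe : w = (x t - xs t) • ((1, 0, 0, 0) : ℝ × ℝ × ℝ × ℝ)
        + (deriv x t - deriv xs t) • ((0, 1, 0, 0) : ℝ × ℝ × ℝ × ℝ)
        + (a - as) • ((0, 0, 1, 0) : ℝ × ℝ × ℝ × ℝ) := by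
      simp [hw]
    have hval : fderiv ℝ G (P t) w = (x t - xs t) * A t
        + (deriv x t - deriv xs t) * B t + (a - as) * C t := by
      rw [hwe, map_add, map_add, map_smul, map_smul, map_smul]
      rfl
    rw [hval] at hs
    simp [slope_def_field, hG, hP, hw] at hs
    linarith
  have hparts : (∫ t in t0..tf, (A t * (x t - xs t) + B t * (deriv x t - deriv xs t))) = 0 := by
    rw [intervalIntegral.integral_eq_sub_of_hasDerivAt (f := fun t => B t * (x t - xs t))]
    · simp [hx0, hxf, hxs0, hxsf]
    · intro t htt
      rw [Set.uIcc_of_le ht.le] at htt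
      exact (hEL t htt).mul (((hx.differentiable one_ne_zero t).hasDerivAt).sub
        ((hxs.differentiable one_ne_zero t).hasDerivAt))
    · exact Continuous.intervalIntegrable (by fun_prop) _ _
  have c1 : Continuous (fun t => g (xs t) (deriv xs t) as t) := hGcont.comp cP
  have c2 : Continuous (fun t => g (x t) (deriv x t) a t) :=
    hGcont.comp (by fun_prop : Continuous fun t => (x t, deriv x t, a, t))
  have c3 : Continuous (fun t => A t * (x t - xs t) + B t * (deriv x t - deriv xs t)) := by
    fun_prop
  have c4 : Continuous (fun t => C t * (a - as)) := by fun_prop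
  have c5 : Continuous (fun t => A t * (x t - xs t) + B t * (deriv x t - deriv xs t)
      + C t * (a - as)) := c3.add c4
  have hm := intervalIntegral.integral_mono_on (μ := MeasureTheory.volume) ht.le
    ((c1.add (c3.add c4)).intervalIntegrable t0 tf) (c2.intervalIntegrable t0 tf) key
  simp only [Pi.add_apply] at hm
  rw [intervalIntegral.integral_add (c1.intervalIntegrable _ _)
      (c5.intervalIntegrable _ _),
    intervalIntegral.integral_add (c3.intervalIntegrable _ _) (c4.intervalIntegrable _ _),
    hparts, intervalIntegral.integral_mul_const, hstat] at hm
  simpa using hm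
end
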